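/- Under the standing hypotheses, there is no edge xy of G whose endpoints lie in distinct g-cycles of G; that is, there do not exist adjacent vertices x and y of G and g-cycles C and D of G with different edge sets such that x lies on C and y lies on D. -/

import Mathlib

open SimpleGraph

/-- Two graphs have the same `k`-deck if there is a bijection between their `k`-element
vertex subsets under which corresponding induced subgraphs are isomorphic. -/
def SameDeck {V W : Type*} [Fintype V] [Fintype W] [DecidableEq V] [DecidableEq W]
    (G : SimpleGraph V) (H : SimpleGraph W) (k : ℕ) : Prop :=
  ∃ e : {s : Finset V // s.card = k} ≃ {s : Finset W // s.card = k},
    ∀ s : {s : Finset V // s.card = k},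
      Nonempty ((G.induce (↑s.1 : Set V)) ≃g (H.induce (↑(e s).1 : Set W)))

namespace CubicDeck

open Finset

variable {V W : Type*}

/-! ### Vertex sets containing cycles -/

/-- Some cycle of `K` has all its vertices in `S`. -/
def HasCycleOn (K : SimpleGraph V) (S : Set V) : Prop :=
  ∃ (u : V) (p : K.Walk u u), p.IsCycle ∧ ∀ z ∈ p.support, z ∈ S

lemma exists_transfer {K M : SimpleGraph V} {S : Set V}
    (hKM : ∀ u ∈ S, ∀ v ∈ S, K.Adj u v → M.Adj u v) {a b : V} (p : K.Walk a b)
    (hp : ∀ z ∈ p.support, z ∈ S) : ∀ e ∈ p.edges, e ∈ M.edgeSet := by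
  intro e he
  induction e with
  | _ u v =>
    exact hKM u (hp u (p.fst_mem_support_of_mem_edges he)) v
      (hp v (p.snd_mem_support_of_mem_edges he)) (p.adj_of_mem_edges he)

lemma HasCycleOn.congr {K M : SimpleGraph V} {S : Set V} (h : HasCycleOn K S)
    (hKM : ∀ u ∈ S, ∀ v ∈ S, K.Adj u v → M.Adj u v) : HasCycleOn M S := by
  obtain ⟨u, p, hp, hs⟩ := h
  refine ⟨u, p.transfer M (exists_transfer hKM p hs), hp.transfer _, ?_⟩
  simpa using hs

lemma HasCycleOn.map {K : SimpleGraph V} {L : SimpleGraph W} (f : K ↪g L) {S : Set V}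
    (h : HasCycleOn K S) : HasCycleOn L (f '' S) := by
  obtain ⟨u, p, hp, hs⟩ := h
  refine ⟨f u, p.map f.toHom, hp.map f.injective, ?_⟩
  intro z hz
  rw [Walk.support_map, List.mem_map] at hz
  obtain ⟨y, hy, rfl⟩ := hz
  exact ⟨y, hs y hy, rfl⟩

lemma hasCycleOn_image_iff {K : SimpleGraph V} {L : SimpleGraph W} (f : K ↪g L) {S : Set V} :
    HasCycleOn L (f '' S) ↔ HasCycleOn K S := by
  refine ⟨?_, fun h => h.map f⟩
  rintro ⟨u, p, hp, hs⟩
  have key : ∀ {a b : W} (q : L.Walk a b), (∀ z ∈ q.support, z ∈ f '' S) →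
      ∃ (a' b' : V) (ha : f a' = a) (hb : f b' = b) (q' : K.Walk a' b'),
        q = (q'.map f.toHom).copy ha hb := by
    intro a b q
    induction q with
    | nil =>
      intro h
      rename_i a
      obtain ⟨y, -, rfl⟩ := h a (by simp)
      exact ⟨y, y, rfl, rfl, Walk.nil, rfl⟩
    | cons hadj q ih =>
      intro h
      obtain ⟨a', b', rfl, rfl, q', rfl⟩ := ih (fun z hz => h z (by simp [hz]))
      obtain ⟨y, -, rfl⟩ := h _ (Walk.start_mem_support _)
      exact ⟨y, b', rfl, rfl, Walk.cons (f.map_adj_iff.1 hadj) q', rfl⟩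
  obtain ⟨a, b, ha, hb, q, hq⟩ := key p hs
  have hab : a = b := f.injective (ha.trans hb.symm)
  subst hab
  subst ha
  subst hq
  refine ⟨a, q, ?_, ?_⟩
  · exact (Walk.isCycle_map_iff_of_injective f.injective).1 hp
  · intro z hz
    obtain ⟨y, hy, hyz⟩ := hs (f z) (by simp [Walk.support_map, hz])
    rwa [← f.injective hyz]

/-- A walk between two distinct neighbours of `x` avoiding `x` closes up to a cycle. -/
lemma hasCycleOn_of_walk {K : SimpleGraph V} {x a b : V} (hxa : K.Adj x a) (hxb : K.Adj x b)
    (hab : a ≠ b) (p : K.Walk a b) (hx : x ∉ p.support) {S : Set V} (hxS : x ∈ S)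
    (hS : ∀ z ∈ p.support, z ∈ S) : HasCycleOn K S := by
  classical
  have hsub := p.support_bypass_subset_support
  refine ⟨x, Walk.cons hxa (p.bypass.concat hxb.symm), ?_, ?_⟩
  · rw [Walk.cons_isCycle_iff]
    refine ⟨?_, ?_⟩
    · exact (p.bypass_isPath).concat (fun h => hx (hsub h)) _
    · rw [Walk.edges_concat, List.concat_eq_append, List.mem_append]
      rintro (h | h)
      · exact hx (hsub (Walk.fst_mem_support_of_mem_edges _ h))
      · simp only [List.mem_singleton, Sym2.eq_iff] at h
        rcases h with ⟨h, -⟩ | ⟨-, h⟩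
        · exact hxb.ne h
        · exact hab h
  · intro z hz
    simp only [Walk.support_cons, Walk.support_concat, List.mem_cons,
      List.mem_append, List.not_mem_nil, or_false] at hz
    rcases hz with rfl | hz | rfl
    · exact hxS
    · exact hS z (hsub hz)
    · exact hxS

lemma card_support_toFinset_le [DecidableEq V] {K : SimpleGraph V} {a b : V} (p : K.Walk a b) :
    p.support.toFinset.card ≤ p.length + 1 := by
  rw [← Walk.length_support]
  exact List.toFinset_card_le _

lemma _root_.SimpleGraph.Walk.IsCycle.card_support_toFinset [DecidableEq V] {K : SimpleGraph V}
    {a : V} {p : K.Walk a a} (hp : p.IsCycle) : p.support.toFinset.card = p.length := by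
  have h1 : p.support.toFinset = p.support.tail.toFinset := by
    ext z
    rw [List.mem_toFinset, List.mem_toFinset]
    refine ⟨fun hz => ?_, fun hz => List.mem_of_mem_tail hz⟩
    rcases (Walk.mem_support_iff p).1 hz with rfl | hz
    · exact Walk.end_mem_tail_support hp.not_nil
    · exact hz
  rw [h1, List.toFinset_card_of_nodup hp.support_nodup, List.length_tail, Walk.length_support]
  rfl

/-- All cycles of `K` have at least `g` vertices. -/
def GirthGE (g : ℕ) (K : SimpleGraph V) : Prop :=
  ∀ S : Finset V, HasCycleOn K S → g ≤ S.card

lemma GirthGE.le_length {g : ℕ} {K : SimpleGraph V} (hg : GirthGE g K) {x a b : V}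
    (hxa : K.Adj x a) (hxb : K.Adj x b) (hab : a ≠ b) (p : K.Walk a b) (hx : x ∉ p.support) :
    g ≤ p.length + 2 := by
  classical
  have h := hg (insert x p.support.toFinset)
    (hasCycleOn_of_walk hxa hxb hab p hx (by simp) (by intro z hz; simp [hz]))
  have h2 := card_insert_le x p.support.toFinset
  have h3 := card_support_toFinset_le p
  omega

/-- The vertex sets of the `g`-cycles of `K`, when `K` has no shorter cycles. -/
noncomputable def cycleSets [Fintype V] (g : ℕ) (K : SimpleGraph V) : Finset (Finset V) :=
  open Classical in univ.filter fun S => S.card = g ∧ HasCycleOn K S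

lemma mem_cycleSets [Fintype V] {g : ℕ} {K : SimpleGraph V} {S : Finset V} :
    S ∈ cycleSets g K ↔ S.card = g ∧ HasCycleOn K S := by
  classical simp [cycleSets]

lemma exists_cycle_of_mem_cycleSets [Fintype V] [DecidableEq V] {g : ℕ} {K : SimpleGraph V}
    (hg : GirthGE g K) {S : Finset V} (hS : S ∈ cycleSets g K) {x : V} (hx : x ∈ S) :
    ∃ p : K.Walk x x, p.IsCycle ∧ p.length = g ∧ p.support.toFinset = S := by
  obtain ⟨hc, u, p, hp, hs⟩ := mem_cycleSets.1 hS
  have hsub : p.support.toFinset ⊆ S := fun z hz => hs z (by simpa using hz)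
  have hge := hg p.support.toFinset ⟨u, p, hp, fun z hz => by simpa using hz⟩
  have heq : p.support.toFinset = S := eq_of_subset_of_card_le hsub (by omega)
  have hxp : x ∈ p.support := by rw [← heq] at hx; simpa using hx
  refine ⟨p.rotate x hxp, hp.rotate hxp, ?_, ?_⟩
  · rw [Walk.length_rotate, ← hp.card_support_toFinset, heq, hc]
  · rw [← heq]
    ext z
    simp

/-- The `g`-cycle with vertex set `S` leaves `x` through two neighbours. -/
lemma exists_arc_of_mem_cycleSets [Fintype V] {g : ℕ} {K : SimpleGraph V}
    (hg : GirthGE g K) {S : Finset V} (hS : S ∈ cycleSets g K) {x : V} (hx : x ∈ S) :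
    ∃ (a b : V) (p : K.Walk a b), K.Adj x a ∧ K.Adj x b ∧ a ≠ b ∧ p.IsPath ∧ p.length + 2 = g ∧
      x ∉ p.support ∧ ∀ z, z ∈ S ↔ z = x ∨ z ∈ p.support := by
  classical
  obtain ⟨c, hc, hl, hs⟩ := exists_cycle_of_mem_cycleSets hg hS hx
  cases c with
  | nil => exact absurd hc (by simp)
  | cons h q =>
    rename_i a
    rw [Walk.cons_isCycle_iff] at hc
    obtain ⟨b, r, h', hq⟩ := Walk.exists_cons_eq_concat h q
    have hqn : ¬ q.Nil := fun hn => h.ne hn.eq.symm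
    have hq' := q.concat_dropLast (Walk.adj_penultimate hqn)
    rw [← hq'] at hc hs hl
    refine ⟨a, q.penultimate, q.dropLast, h, (Walk.adj_penultimate hqn).symm, ?_, ?_, ?_, ?_, ?_⟩
    · intro hab
      apply hc.2
      rw [Walk.edges_concat, List.concat_eq_append, List.mem_append]
      right
      simp only [List.mem_singleton]
      rw [← hab, Sym2.eq_swap]
    · have := hc.1
      rw [Walk.concat_isPath_iff] at this
      exact this.1
    · simp only [Walk.length_cons, Walk.length_concat] at hl
      omega
    · have := hc.1
      rw [Walk.concat_isPath_iff] at this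
      exact this.2
    · intro z
      rw [← hs]
      simp only [Walk.support_cons, Walk.support_concat, List.mem_toFinset, List.mem_cons,
        List.mem_append, List.not_mem_nil, or_false]
      tauto

/-- Splitting a walk at its first vertex in `X`. -/
lemma exists_first_hit {K : SimpleGraph V} (X : Set V) {a b : V} (p : K.Walk a b) (ha : a ∉ X)
    (hb : b ∈ X) : ∃ (u s : V) (q : K.Walk a u) (h : K.Adj u s) (r : K.Walk s b),
      s ∈ X ∧ (∀ z ∈ q.support, z ∉ X) ∧ p = q.append (Walk.cons h r) := by
  induction p with
  | nil => exact absurd hb ha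
  | @cons a c b h p ih =>
    by_cases hc : c ∈ X
    · exact ⟨a, c, Walk.nil, h, p, hc, by simpa using ha, rfl⟩
    · obtain ⟨u, s, q, h', r, hs, hq, rfl⟩ := ih hc hb
      refine ⟨u, s, Walk.cons h q, h', r, hs, ?_, rfl⟩
      intro z hz
      rw [Walk.support_cons, List.mem_cons] at hz
      rcases hz with rfl | hz
      · exact ha
      · exact hq z hz

/-- Some walk of length at most `k` joins `u` to `v` and avoids `X`. -/
def Linked (K : SimpleGraph V) (X : Set V) (k : ℕ) (u v : V) : Prop :=
  ∃ p : K.Walk u v, p.length ≤ k ∧ ∀ z ∈ p.support, z ∉ X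

namespace Linked

variable {K M : SimpleGraph V} {X Y : Set V} {k l : ℕ} {u v x : V}

lemma symm (h : Linked K X k u v) : Linked K X k v u := by
  obtain ⟨p, hp, hX⟩ := h
  exact ⟨p.reverse, by simpa using hp, by simpa using hX⟩

lemma mono (h : Linked K X k u v) (hYX : Y ⊆ X) (hkl : k ≤ l) : Linked K Y l u v := by
  obtain ⟨p, hp, hX⟩ := h
  exact ⟨p, hp.trans hkl, fun z hz hY => hX z hz (hYX hY)⟩

lemma congr (h : Linked K X k u v) (hKM : ∀ a ∉ X, ∀ b ∉ X, K.Adj a b → M.Adj a b) :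
    Linked M X k u v := by
  obtain ⟨p, hp, hX⟩ := h
  refine ⟨p.transfer M (exists_transfer (S := Xᶜ) hKM p hX), by simpa using hp, by simpa using hX⟩

lemma left_notMem (h : Linked K X k u v) : u ∉ X := by
  obtain ⟨p, -, hX⟩ := h
  exact hX u p.start_mem_support

lemma right_notMem (h : Linked K X k u v) : v ∉ X := h.symm.left_notMem

lemma cons (h : Linked K X k u v) (hxu : K.Adj x u) (hx : x ∉ X) : Linked K X (k + 1) x v := by
  obtain ⟨p, hp, hX⟩ := h
  refine ⟨Walk.cons hxu p, by simpa using hp, ?_⟩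
  intro z hz
  rw [Walk.support_cons, List.mem_cons] at hz
  rcases hz with rfl | hz
  · exact hx
  · exact hX z hz

/-- The first step of a link between distinct vertices. -/
lemma exists_step (h : Linked K X k u v) (huv : u ≠ v) :
    ∃ t, K.Adj u t ∧ 1 ≤ k ∧ Linked K X (k - 1) t v := by
  obtain ⟨p, hp, hX⟩ := h
  cases p with
  | nil => exact absurd rfl huv
  | cons h p =>
    rw [Walk.length_cons] at hp
    exact ⟨_, h, by omega, p, by omega, fun z hz => hX z (by simp [hz])⟩

/-- Either a link avoids `x`, or it contains a link from `x`. -/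
lemma avoid_or (h : Linked K X k u v) (x : V) :
    Linked K (X ∪ {x}) k u v ∨ Linked K X k x v := by
  classical
  obtain ⟨p, hp, hX⟩ := h
  by_cases hx : x ∈ p.support
  · right
    refine ⟨p.dropUntil x hx, ?_, fun z hz => hX z (p.support_dropUntil_subset_support hx hz)⟩
    have := congrArg Walk.length (p.take_spec hx)
    rw [Walk.length_append] at this
    omega
  · left
    refine ⟨p, hp, ?_⟩
    rintro z hz (h | rfl)
    · exact hX z hz h
    · exact hx hz

end Linked

lemma GirthGE.le_of_linked {g k : ℕ} {K : SimpleGraph V} (hg : GirthGE g K) {x a b : V}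
    (hxa : K.Adj x a) (hxb : K.Adj x b) (hab : a ≠ b) (h : Linked K {x} k a b) : g ≤ k + 2 := by
  obtain ⟨p, hp, hX⟩ := h
  have := hg.le_length hxa hxb hab p (fun hx => hX x hx rfl)
  omega

/-! ### Cubic graphs that agree outside two vertices -/

/-- The neighbours of `x`. -/
noncomputable def nbr [Fintype V] (K : SimpleGraph V) (x : V) : Finset V :=
  open Classical in univ.filter (K.Adj x)

@[simp] lemma mem_nbr [Fintype V] {K : SimpleGraph V} {x u : V} : u ∈ nbr K x ↔ K.Adj x u := by
  simp [nbr]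

/-- Every vertex has exactly three neighbours. -/
def Cubic [Fintype V] (K : SimpleGraph V) : Prop :=
  ∀ x, (nbr K x).card = 3

lemma Cubic.of_iso [Fintype V] [Fintype W] {K : SimpleGraph V} {L : SimpleGraph W}
    (hL : Cubic L) (f : K ≃g L) : Cubic K := by
  classical
  intro x
  rw [← hL (f x), ← card_map f.toEmbedding.toEmbedding]
  congr 1
  ext u
  simp only [mem_map, mem_nbr]
  constructor
  · rintro ⟨v, hv, rfl⟩
    exact f.map_adj_iff.2 hv
  · intro hu
    refine ⟨f.symm u, ?_, by simp⟩
    rw [← f.map_adj_iff]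
    simpa using hu

/-- `K` and `M` have the same edges outside `X`. -/
def AgreeOff (K M : SimpleGraph V) (X : Set V) : Prop :=
  ∀ u ∉ X, ∀ v ∉ X, (K.Adj u v ↔ M.Adj u v)

namespace AgreeOff

variable {K L M : SimpleGraph V} {X Y : Set V}

lemma symm (h : AgreeOff K M X) : AgreeOff M K X := fun u hu v hv => (h u hu v hv).symm

lemma trans (h : AgreeOff K M X) (h' : AgreeOff M L X) : AgreeOff K L X :=
  fun u hu v hv => (h u hu v hv).trans (h' u hu v hv)

lemma mono (h : AgreeOff K M X) (hXY : X ⊆ Y) : AgreeOff K M Y :=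
  fun u hu v hv => h u (fun h' => hu (hXY h')) v (fun h' => hv (hXY h'))

lemma linked {k : ℕ} {u v : V} (h : AgreeOff K M X) (hl : Linked K Y k u v) (hXY : X ⊆ Y) :
    Linked M Y k u v :=
  hl.congr fun a ha b hb => ((h.mono hXY) a ha b hb).1

end AgreeOff

/-- The graph obtained from `K` by exchanging the names of `x` and `y`. -/
def swapped [DecidableEq V] (K : SimpleGraph V) (x y : V) : SimpleGraph V :=
  K.comap (Equiv.swap x y)

def swappedIso [DecidableEq V] (K : SimpleGraph V) (x y : V) : swapped K x y ≃g K :=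
  Iso.comap (Equiv.swap x y) K

section Switch

variable [Fintype V] [DecidableEq V] {K M : SimpleGraph V} {x y : V}

lemma AgreeOff.adj_and_or (hK : Cubic K) (hM : Cubic M) (hxy : x ≠ y)
    (h : AgreeOff K M {x, y}) {u : V} (hux : u ≠ x) (huy : u ≠ y) :
    ((K.Adj x u ∧ K.Adj y u) ↔ (M.Adj x u ∧ M.Adj y u)) ∧
      ((K.Adj x u ∨ K.Adj y u) ↔ (M.Adj x u ∨ M.Adj y u)) := by
  have e1 : nbr K u \ {x, y} = nbr M u \ {x, y} := by
    ext v
    simp only [mem_sdiff, mem_nbr, mem_insert, mem_singleton]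
    refine and_congr_left fun hv => h u ?_ v ?_ <;> simp_all
  have e2 : (nbr K u ∩ {x, y}).card = (nbr M u ∩ {x, y}).card := by
    have k1 := card_sdiff_add_card_inter (nbr K u) {x, y}
    have k2 := card_sdiff_add_card_inter (nbr M u) {x, y}
    rw [hK u] at k1
    rw [hM u] at k2
    rw [e1] at k1
    omega
  have e3 : ∀ N : SimpleGraph V, nbr N u ∩ {x, y} =
      (({x, y} : Finset V).filter fun v => v ∈ nbr N u) := by
    intro N
    ext v
    simp [and_comm]
  rw [e3, e3, filter_insert, filter_singleton, filter_insert, filter_singleton] at e2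
  rw [K.adj_comm x u, K.adj_comm y u, M.adj_comm x u, M.adj_comm y u]
  clear e1 h
  by_cases h1 : K.Adj u x <;> by_cases h2 : K.Adj u y <;> by_cases h3 : M.Adj u x <;>
    by_cases h4 : M.Adj u y <;> simp_all

lemma AgreeOff.inter_union (hK : Cubic K) (hM : Cubic M) (hxy : x ≠ y)
    (h : AgreeOff K M {x, y}) :
    (nbr K x).erase y ∩ (nbr K y).erase x = (nbr M x).erase y ∩ (nbr M y).erase x ∧
      (nbr K x).erase y ∪ (nbr K y).erase x = (nbr M x).erase y ∪ (nbr M y).erase x := by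
  have key := fun u (hux : u ≠ x) (huy : u ≠ y) => h.adj_and_or hK hM hxy hux huy
  constructor
  · ext u
    simp only [mem_inter, mem_erase, mem_nbr]
    have := key u
    tauto
  · ext u
    simp only [mem_union, mem_erase, mem_nbr]
    by_cases hux : u = x
    · subst hux; simp
    by_cases huy : u = y
    · subst huy; simp
    have := key u
    tauto

open Classical in
lemma Cubic.card_erase (hK : Cubic K) (x y : V) :
    ((nbr K x).erase y).card = if K.Adj x y then 2 else 3 := by
  simp [card_erase_eq_ite, hK x]

lemma Cubic.card_erase_comm (hK : Cubic K) (x y : V) :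
    ((nbr K y).erase x).card = ((nbr K x).erase y).card := by
  rw [hK.card_erase, hK.card_erase]
  classical exact if_congr (K.adj_comm y x) rfl rfl

lemma Cubic.card_erase_eq (hK : Cubic K) (hM : Cubic M) (h : K.Adj x y ↔ M.Adj x y) :
    ((nbr M x).erase y).card = ((nbr K x).erase y).card := by
  rw [hK.card_erase, hM.card_erase]
  classical exact if_congr h.symm rfl rfl

lemma AgreeOff.adj_iff (hK : Cubic K) (hM : Cubic M) (hxy : x ≠ y)
    (h : AgreeOff K M {x, y}) : K.Adj x y ↔ M.Adj x y := by
  obtain ⟨h1, h2⟩ := h.inter_union hK hM hxy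
  have k1 := card_union_add_card_inter ((nbr K x).erase y) ((nbr K y).erase x)
  have k2 := card_union_add_card_inter ((nbr M x).erase y) ((nbr M y).erase x)
  rw [h1, h2, k2] at k1
  simp only [hK.card_erase_comm x y, hM.card_erase_comm x y, hK.card_erase, hM.card_erase] at k1
  clear h h1 h2 k2
  by_cases h3 : K.Adj x y <;> by_cases h4 : M.Adj x y <;> simp_all

lemma AgreeOff.eq_of_erase_eq (hK : Cubic K) (hM : Cubic M) (hxy : x ≠ y)
    (h : AgreeOff K M {x, y}) (he : (nbr K x).erase y = (nbr M x).erase y) : K = M := by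
  have hadj := h.adj_iff hK hM hxy
  have hx : ∀ u, u ≠ y → (K.Adj x u ↔ M.Adj x u) := by
    intro u hu
    have := congrArg (u ∈ ·) he
    simpa [hu] using this
  have hx' : ∀ u, K.Adj x u ↔ M.Adj x u := by
    intro u
    by_cases hu : u = y
    · subst hu; exact hadj
    · exact hx u hu
  have hy' : ∀ u, K.Adj y u ↔ M.Adj y u := by
    intro u
    by_cases hux : u = x
    · subst hux; rw [K.adj_comm, M.adj_comm]; exact hadj
    by_cases huy : u = y
    · subst huy; simp
    have := h.adj_and_or hK hM hxy hux huy
    have := hx' u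
    tauto
  ext u v
  by_cases hux : u = x
  · subst hux; exact hx' v
  by_cases huy : u = y
  · subst huy; exact hy' v
  by_cases hvx : v = x
  · subst hvx; rw [K.adj_comm, M.adj_comm]; exact hx' u
  by_cases hvy : v = y
  · subst hvy; rw [K.adj_comm, M.adj_comm]; exact hy' u
  exact h u (by simp [hux, huy]) v (by simp [hvx, hvy])

omit [Fintype V] in
lemma swapped_adj_left {u : V} (hux : u ≠ x) (huy : u ≠ y) :
    (swapped M x y).Adj x u ↔ M.Adj y u := by
  simp [swapped, Equiv.swap_apply_of_ne_of_ne hux huy]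

omit [Fintype V] in
lemma agreeOff_swapped : AgreeOff M (swapped M x y) {x, y} := by
  intro u hu v hv
  simp only [Set.mem_insert_iff, Set.mem_singleton_iff, not_or] at hu hv
  simp [swapped, Equiv.swap_apply_of_ne_of_ne hu.1 hu.2, Equiv.swap_apply_of_ne_of_ne hv.1 hv.2]

omit [Fintype V] in
/-- Two pairs of sets with the same intersection and union, of the same size,
differ by an exchange when the differences are small. -/
lemma exists_exchange {A B A' B' : Finset V} (hi : A ∩ B = A' ∩ B') (hu : A ∪ B = A' ∪ B')
    (hB : B.card = A.card) (hA' : A'.card = A.card) (hne : A ≠ A') (hne' : B ≠ A')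
    (h2 : (A \ B).card ≤ 2) {a : V} (ha : a ∈ A) (haB : a ∉ B) (haA' : a ∉ A') :
    ∃ c ∈ B, c ∉ A ∧ (∀ u, u ∈ A' ↔ (u ∈ A ∧ u ≠ a) ∨ u = c) ∧
      ∀ u, u ∈ B' ↔ (u ∈ B ∧ u ≠ c) ∨ u = a := by
  have hi' := fun u => congrArg (u ∈ ·) hi
  have hu' := fun u => congrArg (u ∈ ·) hu
  simp only [mem_inter, mem_union, eq_iff_iff] at hi' hu'
  obtain ⟨a', ha', ha'B⟩ : ∃ a' ∈ A', a' ∉ B := by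
    by_contra! hsub
    exact hne' (eq_of_subset_of_card_le hsub (by omega)).symm
  have ha'A : a' ∈ A := by grind
  obtain ⟨c, hc, hcA⟩ : ∃ c ∈ A', c ∉ A := by
    by_contra! hsub
    exact hne (eq_of_subset_of_card_le hsub (by omega)).symm
  have hcB : c ∈ B := by grind
  have hca' : c ≠ a' := by rintro rfl; exact hcA ha'A
  have haa' : a ≠ a' := by rintro rfl; exact haA' ha'
  have hD : A \ B = {a, a'} := by
    symm
    apply eq_of_subset_of_card_le
    · intro z
      simp only [mem_insert, mem_singleton, mem_sdiff]
      rintro (rfl | rfl)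
      · exact ⟨ha, haB⟩
      · exact ⟨ha'A, ha'B⟩
    · rw [card_pair haa']; exact h2
  have hD' : ∀ u, u ∈ A → u ∉ B → u = a ∨ u = a' := by
    intro u h h'
    have : u ∈ A \ B := by simp [h, h']
    rw [hD] at this
    simpa using this
  have hsub : insert c (A.erase a) ⊆ A' := by
    intro z
    simp only [mem_insert, mem_erase]
    rintro (rfl | ⟨hz, hzA⟩)
    · exact hc
    · by_cases hzB : z ∈ B
      · exact ((hi' z).1 ⟨hzA, hzB⟩).1
      · rcases hD' z hzA hzB with rfl | rfl
        · exact absurd rfl hz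
        · exact ha'
  have heq : insert c (A.erase a) = A' := by
    apply eq_of_subset_of_card_le hsub
    rw [card_insert_of_notMem (by simp [hcA]), card_erase_of_mem ha]
    omega
  have hmem : ∀ u, u ∈ A' ↔ (u ∈ A ∧ u ≠ a) ∨ u = c := by
    intro u
    rw [← heq]
    grind
  refine ⟨c, hcB, hcA, hmem, ?_⟩
  intro u
  have k1 := hi' u
  have k2 := hu' u
  have k3 := hmem u
  clear hD' hi' hu' hmem heq hsub hD hi hu
  grind

lemma AgreeOff.nonempty_iso_of_left_right (hK : Cubic K) (hM : Cubic M) (hxy : x ≠ y)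
    (h : AgreeOff K M {x, y}) (he : (nbr K y).erase x = (nbr M x).erase y) :
    Nonempty (K ≃g M) := by
  have hM' : Cubic (swapped M x y) := hM.of_iso (swappedIso M x y)
  have key : K = swapped M x y := by
    refine AgreeOff.eq_of_erase_eq hK hM' hxy (h.trans agreeOff_swapped) ?_
    ext u
    simp only [mem_erase, mem_nbr]
    by_cases huy : u = y
    · simp [huy]
    by_cases hux : u = x
    · simp [hux]
    rw [swapped_adj_left hux huy]
    have k0 := congrArg (u ∈ ·) he
    have k1 := h.adj_and_or hK hM hxy hux huy
    simp only [mem_erase, mem_nbr, eq_iff_iff] at k0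
    tauto
  rw [key]
  exact ⟨swappedIso M x y⟩

/-- Exchanging one private neighbour of `x` with one of `y`. -/
lemma AgreeOff.exists_switch (hK : Cubic K) (hM : Cubic M) (hxy : x ≠ y)
    (h : AgreeOff K M {x, y}) (hiso : ¬ Nonempty (K ≃g M))
    (hnear : K.Adj x y ∨ ∃ z, K.Adj x z ∧ K.Adj y z) {a : V} (ha : K.Adj x a) (hay : a ≠ y)
    (hya : ¬ K.Adj y a) :
    ∃ c, K.Adj y c ∧ c ≠ x ∧ ¬ K.Adj x c ∧ ∃ N : SimpleGraph V, Nonempty (N ≃g M) ∧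
      AgreeOff K N {x, y} ∧ (N.Adj x y ↔ K.Adj x y) ∧
      (∀ u, u ≠ x → u ≠ y → (N.Adj x u ↔ (K.Adj x u ∧ u ≠ a) ∨ u = c)) ∧
      (∀ u, u ≠ x → u ≠ y → (N.Adj y u ↔ (K.Adj y u ∧ u ≠ c) ∨ u = a)) := by
  obtain ⟨N, hN, hKN, haN⟩ : ∃ N : SimpleGraph V, Nonempty (N ≃g M) ∧
      AgreeOff K N {x, y} ∧ ¬ N.Adj x a := by
    by_cases hxa : M.Adj x a
    · refine ⟨swapped M x y, ⟨swappedIso M x y⟩, h.trans agreeOff_swapped, ?_⟩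
      rw [swapped_adj_left ha.ne' hay]
      have := h.adj_and_or hK hM hxy ha.ne' hay
      tauto
    · exact ⟨M, ⟨Iso.refl⟩, h, hxa⟩
  have hNc : Cubic N := hM.of_iso hN.some
  have hiso' : ¬ Nonempty (K ≃g N) := fun ⟨f⟩ => hiso ⟨f.trans hN.some⟩
  obtain ⟨hi, hu⟩ := hKN.inter_union hK hNc hxy
  have hadj := hKN.adj_iff hK hNc hxy
  obtain ⟨c, hc, hcA, h1, h2⟩ := exists_exchange hi hu
    (hK.card_erase_comm x y) (hK.card_erase_eq hNc hadj)
    (fun he => hiso' (by rw [hKN.eq_of_erase_eq hK hNc hxy he]; exact ⟨Iso.refl⟩))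
    (fun he => hiso' (hKN.nonempty_iso_of_left_right hK hNc hxy he))
    (by
      rcases hnear with hn | ⟨z, hz, hz'⟩
      · have := card_le_card (sdiff_subset : (nbr K x).erase y \ (nbr K y).erase x ⊆ _)
        rw [hK.card_erase, if_pos (by simpa using hn)] at this
        exact this
      · have hsub : (nbr K x).erase y \ (nbr K y).erase x ⊆ (nbr K x).erase z := by
          intro u
          simp only [mem_sdiff, mem_erase, mem_nbr]
          rintro ⟨⟨huy, hux⟩, hnot⟩
          refine ⟨?_, hux⟩
          rintro rfl
          exact hnot ⟨hux.ne', hz'⟩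
        have := card_le_card hsub
        rw [hK.card_erase, if_pos (by simpa using hz)] at this
        exact this)
    (a := a) (by simp [hay, ha]) (by simp [hya]) (by simp [haN])
  simp only [mem_erase, mem_nbr] at hc hcA h1 h2
  have hcy : c ≠ y := hc.2.ne'
  refine ⟨c, hc.2, hc.1, fun hxc => hcA ⟨hcy, hxc⟩, N, hN, hKN, hadj.symm, ?_, ?_⟩
  · intro u hux huy
    have := h1 u
    tauto
  · intro u hux huy
    have := h2 u
    tauto

lemma AgreeOff.two_le_card_sdiff (hK : Cubic K) (hM : Cubic M) (hxy : x ≠ y)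
    (h : AgreeOff K M {x, y}) (hiso : ¬ Nonempty (K ≃g M)) :
    2 ≤ ((nbr K x).erase y \ (nbr K y).erase x).card := by
  by_contra! hlt
  obtain ⟨hi, hu⟩ := h.inter_union hK hM hxy
  have hadj := h.adj_iff hK hM hxy
  have hB : ((nbr K y).erase x).card = ((nbr K x).erase y).card  :=
    hK.card_erase_comm x y
  have hA' : ((nbr M x).erase y).card = ((nbr K x).erase y).card  :=
    hK.card_erase_eq hM hadj
  have hne : (nbr K x).erase y ≠ (nbr M x).erase y :=
    fun he => hiso (by rw [h.eq_of_erase_eq hK hM hxy he]; exact ⟨Iso.refl⟩)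
  have hne' : (nbr K y).erase x ≠ (nbr M x).erase y :=
    fun he => hiso (h.nonempty_iso_of_left_right hK hM hxy he)
  generalize (nbr K x).erase y = A at *
  generalize (nbr K y).erase x = B at *
  generalize (nbr M x).erase y = A' at *
  generalize (nbr M y).erase x = B' at *
  obtain ⟨a, ha, haA'⟩ : ∃ a ∈ A, a ∉ A' := by
    by_contra! hsub
    exact hne (eq_of_subset_of_card_le hsub (by omega))
  obtain ⟨a', ha', ha'B⟩ : ∃ a' ∈ A', a' ∉ B := by
    by_contra! hsub
    exact hne' (eq_of_subset_of_card_le hsub (by omega)).symm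
  have k1 := congrArg (a ∈ ·) hi
  have k2 := congrArg (a' ∈ ·) hu
  simp only [mem_inter, mem_union, eq_iff_iff] at k1 k2
  have hm : a ∈ A \ B := by simp only [mem_sdiff]; tauto
  have hm' : a' ∈ A \ B := by simp only [mem_sdiff]; tauto
  have := card_le_one.1 (by omega) a hm a' hm'
  subst this
  exact haA' ha'

end Switch

/-! ### Graphs with the same deck -/

/-- For every pair of vertices, some copy of `L` agrees with `K` outside that pair. -/
def CardRel (K : SimpleGraph V) (L : SimpleGraph W) : Prop :=
  ∀ x y, x ≠ y → ∃ M : SimpleGraph V, Nonempty (M ≃g L) ∧ AgreeOff K M {x, y}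

lemma CardRel.trans_iso {U : Type*} {K : SimpleGraph V} {L : SimpleGraph W} {L' : SimpleGraph U}
    (h : CardRel K L) (f : L ≃g L') : CardRel K L' := by
  intro x y hxy
  obtain ⟨M, ⟨m⟩, hM⟩ := h x y hxy
  exact ⟨M, ⟨m.trans f⟩, hM⟩

lemma CardRel.iso_trans {U : Type*} {K : SimpleGraph V} {L : SimpleGraph W} {K' : SimpleGraph U}
    (h : CardRel K L) (f : K' ≃g K) : CardRel K' L := by
  intro x y hxy
  obtain ⟨M, ⟨m⟩, hM⟩ := h (f x) (f y) (fun he => hxy (f.injective he))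
  refine ⟨M.comap f, ⟨(Iso.comap f.toEquiv M).trans m⟩, ?_⟩
  intro u hu v hv
  rw [← f.map_adj_iff]
  simp only [Set.mem_insert_iff, Set.mem_singleton_iff, not_or] at hu hv
  exact hM (f u) (by simp [f.injective.eq_iff, hu]) (f v) (by simp [f.injective.eq_iff, hv])

/-- Non-isomorphic cubic graphs related by their cards. -/
structure Mate [Fintype V] [Fintype W] (K : SimpleGraph V) (L : SimpleGraph W) : Prop where
  cubic_left : Cubic K
  cubic_right : Cubic L
  left : CardRel K L
  right : CardRel L K
  not_iso : ¬ Nonempty (K ≃g L)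

namespace Mate

variable [Fintype V] [Fintype W] {K : SimpleGraph V} {L : SimpleGraph W}

lemma symm (h : Mate K L) : Mate L K where
  cubic_left := h.cubic_right
  cubic_right := h.cubic_left
  left := h.right
  right := h.left
  not_iso := fun ⟨f⟩ => h.not_iso ⟨f.symm⟩

lemma trans_iso {U : Type*} [Fintype U] {M : SimpleGraph U} (h : Mate K L) (f : L ≃g M) :
    Mate K M where
  cubic_left := h.cubic_left
  cubic_right := h.cubic_right.of_iso f.symm
  left := h.left.trans_iso f
  right := h.right.iso_trans f.symm
  not_iso := fun ⟨e⟩ => h.not_iso ⟨e.trans f.symm⟩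

lemma two_le [DecidableEq V] (h : Mate K L) {x y : V} (hxy : x ≠ y) :
    2 ≤ ((nbr K x).erase y \ (nbr K y).erase x).card := by
  obtain ⟨M, ⟨m⟩, hM⟩ := h.left x y hxy
  exact hM.two_le_card_sdiff h.cubic_left (h.cubic_right.of_iso m) hxy
    fun ⟨e⟩ => h.not_iso ⟨e.trans m⟩

lemma no_triangle (h : Mate K L) {x y z : V} (hxy : K.Adj x y) (hxz : K.Adj x z)
    (hyz : K.Adj y z) : False := by
  classical
  have h2 := h.two_le hxy.ne
  have hsub : (nbr K x).erase y \ (nbr K y).erase x ⊆ ((nbr K x).erase y).erase z := by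
    intro u
    simp only [mem_sdiff, mem_erase, mem_nbr]
    rintro ⟨⟨huy, hux⟩, hnot⟩
    refine ⟨?_, huy, hux⟩
    rintro rfl
    exact hnot ⟨hux.ne', hyz⟩
  have h3 := card_le_card hsub
  rw [card_erase_of_mem (by simp [hxz, hyz.ne']), card_erase_of_mem (by simp [hxy]),
    h.cubic_left] at h3
  omega

lemma no_square (h : Mate K L) {x y a b : V} (hxy : x ≠ y) (hab : a ≠ b) (hxa : K.Adj x a)
    (hya : K.Adj y a) (hxb : K.Adj x b) (hyb : K.Adj y b) : False := by
  classical
  have h2 := h.two_le hxy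
  have hsub : (nbr K x).erase y \ (nbr K y).erase x ⊆ ((nbr K x).erase a).erase b := by
    intro u
    simp only [mem_sdiff, mem_erase, mem_nbr]
    rintro ⟨⟨huy, hux⟩, hnot⟩
    refine ⟨?_, ?_, hux⟩
    · rintro rfl
      exact hnot ⟨hux.ne', hyb⟩
    · rintro rfl
      exact hnot ⟨hux.ne', hya⟩
  have h3 := card_le_card hsub
  rw [card_erase_of_mem (by simp [hxb, hab.symm]), card_erase_of_mem (by simp [hxa]),
    h.cubic_left] at h3
  omega

lemma five_le (h : Mate K L) {g : ℕ} (hg : GirthGE g K) {S : Finset V}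
    (hS : S ∈ cycleSets g K) : 5 ≤ g := by
  obtain ⟨x, hx⟩ : S.Nonempty := by
    obtain ⟨-, u, p, -, hp⟩ := mem_cycleSets.1 hS
    exact ⟨u, hp u p.start_mem_support⟩
  obtain ⟨a, b, p, hxa, hxb, hab, hp, hl, hxp, -⟩ := exists_arc_of_mem_cycleSets hg hS hx
  by_contra! hlt
  cases p with
  | nil => exact hab rfl
  | cons h1 p =>
    cases p with
    | nil => exact h.no_triangle hxa hxb h1
    | cons h2 p =>
      cases p with
      | nil =>
        refine h.no_square (x := x) ?_ hab hxa h1.symm hxb h2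
        rintro rfl
        simp at hxp
      | cons h3 p =>
        simp only [Walk.length_cons] at hl
        omega

end Mate

section Deck

variable [Fintype V] [Fintype W]

omit [Fintype V] [Fintype W] in
lemma GirthGE.of_embedding {g : ℕ} {K : SimpleGraph V} {L : SimpleGraph W} (hL : GirthGE g L)
    (f : K ↪g L) : GirthGE g K := by
  intro S hS
  have := hL (S.map f.toEmbedding) (by simpa using hS.map f)
  simpa using this

lemma card_filter_cycleSets {g : ℕ} {K : SimpleGraph V} {L : SimpleGraph W} (f : K ↪g L)
    (T : Finset W) (hT : Set.range f = T) [DecidablePred (· ⊆ T)] :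
    ((cycleSets g L).filter (· ⊆ T)).card = (cycleSets g K).card := by
  classical
  symm
  rw [← card_map (mapEmbedding f.toEmbedding).toEmbedding]
  congr 1
  ext S
  simp only [mem_map, mem_filter, mem_cycleSets]
  constructor
  · rintro ⟨S', ⟨hc, hS'⟩, rfl⟩
    refine ⟨⟨by simpa using hc, by simpa using hS'.map f⟩, ?_⟩
    intro z hz
    obtain ⟨y, -, rfl⟩ := mem_map.1 hz
    rw [← mem_coe, ← hT]
    exact ⟨y, rfl⟩
  · rintro ⟨⟨hc, hS⟩, hST⟩
    have hS' : (S : Set W) ⊆ Set.range f := by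
      rw [hT]
      exact_mod_cast hST
    have hmap : (univ.filter fun v => f v ∈ S).map f.toEmbedding = S := by
      ext z
      simp only [mem_map, mem_filter, mem_univ, true_and]
      constructor
      · rintro ⟨y, hy, rfl⟩
        exact hy
      · intro hz
        obtain ⟨y, rfl⟩ := hS' (mem_coe.2 hz)
        exact ⟨y, hz, rfl⟩
    refine ⟨univ.filter fun v => f v ∈ S, ⟨?_, ?_⟩, hmap⟩
    · rw [← hc, ← card_map f.toEmbedding, hmap]
    · rw [← hasCycleOn_image_iff f]
      rw [← hmap] at hS
      simpa using hS

lemma card_cycleSets_of_iso {g : ℕ} {K : SimpleGraph V} {L : SimpleGraph W} (f : K ≃g L) :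
    (cycleSets g K).card = (cycleSets g L).card := by
  classical
  rw [← card_filter_cycleSets f.toEmbedding univ (by simp)]
  simp

lemma card_supersets [DecidableEq V] {k : ℕ} (hk : k + 2 = Fintype.card V) (S : Finset V) :
    ((univ : Finset {s : Finset V // s.card = k}).filter fun T => S ⊆ T.1).card =
      (Fintype.card V - S.card).choose 2 := by
  rw [← card_compl, ← card_powersetCard]
  refine card_bij' (fun T _ => T.1ᶜ)
    (fun P hP => ⟨Pᶜ, by rw [card_compl, (mem_powersetCard.1 hP).2]; omega⟩) ?_ ?_ ?_ ?_
  · rintro ⟨T, hT⟩ hST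
    rw [mem_powersetCard, compl_subset_compl, card_compl]
    simp only [mem_filter, mem_univ, true_and] at hST
    exact ⟨hST, by rw [hT]; omega⟩
  · intro P hP
    simp only [mem_filter, mem_univ, true_and]
    have := (mem_powersetCard.1 hP).1
    rwa [subset_compl_comm]
  · rintro ⟨T, hT⟩ _
    simp
  · intro P hP
    simp

lemma sum_card_filter_cycleSets [DecidableEq V] {g k : ℕ} (hk : k + 2 = Fintype.card V)
    (K : SimpleGraph V) :
    ∑ T : {s : Finset V // s.card = k}, ((cycleSets g K).filter (· ⊆ T.1)).card =
      (cycleSets g K).card * (Fintype.card V - g).choose 2 := by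
  have h := sum_card_bipartiteAbove_eq_sum_card_bipartiteBelow (s := cycleSets g K)
    (t := (univ : Finset {s : Finset V // s.card = k})) (fun S T => S ⊆ T.1)
  simp only [bipartiteAbove, bipartiteBelow] at h
  rw [← h, sum_const_nat]
  intro S hS
  rw [card_supersets hk, (mem_cycleSets.1 hS).1]

variable [DecidableEq V] [DecidableEq W] {G : SimpleGraph V} {H : SimpleGraph W}

lemma _root_.SameDeck.symm {k : ℕ} (h : SameDeck G H k) : SameDeck H G k := by
  obtain ⟨e, he⟩ := h
  refine ⟨e.symm, fun s => ?_⟩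
  obtain ⟨f⟩ := he (e.symm s)
  rw [e.apply_symm_apply] at f
  exact ⟨f.symm⟩

lemma _root_.SameDeck.cardRel (hcard : Fintype.card V = Fintype.card W)
    (h : SameDeck G H (Fintype.card V - 2)) : CardRel G H := by
  intro x y hxy
  obtain ⟨e, he⟩ := h
  have hs : ({x, y}ᶜ : Finset V).card = Fintype.card V - 2 := by
    rw [card_compl, card_pair hxy]
  set s : {s : Finset V // s.card = Fintype.card V - 2} := ⟨{x, y}ᶜ, hs⟩ with hsdef
  obtain ⟨f⟩ := he s
  have hc : Fintype.card {v // ¬ v ∈ (s.1 : Set V)} =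
      Fintype.card {w // ¬ w ∈ ((e s).1 : Set W)} := by
    rw [Fintype.card_subtype_compl, Fintype.card_subtype_compl, Fintype.card_congr f.toEquiv]
    exact congrArg (· - _) hcard
  let c := Fintype.equivOfCardEq hc
  let F : V ≃ W := (Equiv.sumCompl (· ∈ (s.1 : Set V))).symm.trans
    ((Equiv.sumCongr f.toEquiv c).trans (Equiv.sumCompl (· ∈ ((e s).1 : Set W))))
  have hF : ∀ v (hv : v ∈ (s.1 : Set V)), F v = (f ⟨v, hv⟩ : W) := by
    intro v hv
    simp only [F, Equiv.trans_apply]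
    rw [Equiv.sumCompl_symm_apply_of_pos hv]
    rfl
  refine ⟨H.comap F, ⟨Iso.comap F H⟩, ?_⟩
  intro u hu v hv
  have hu' : u ∈ (s.1 : Set V) := by simpa [hsdef, and_comm] using hu
  have hv' : v ∈ (s.1 : Set V) := by simpa [hsdef, and_comm] using hv
  rw [comap_adj, hF u hu', hF v hv']
  have := f.map_adj_iff (v := ⟨u, hu'⟩) (w := ⟨v, hv'⟩)
  simp only [comap_adj, Function.Embedding.subtype_apply] at this
  exact this.symm

lemma _root_.SameDeck.card_cycleSets {g : ℕ} (hcard : Fintype.card V = Fintype.card W)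
    (h : SameDeck G H (Fintype.card V - 2)) (hg : g + 2 ≤ Fintype.card V) :
    (cycleSets g G).card = (cycleSets g H).card := by
  have h1 := sum_card_filter_cycleSets (g := g) (k := Fintype.card V - 2) (by omega) G
  have h2 := sum_card_filter_cycleSets (g := g) (k := Fintype.card V - 2) (by omega) H
  have hpos : 0 < (Fintype.card V - g).choose 2 := Nat.choose_pos (by omega)
  refine Nat.eq_of_mul_eq_mul_right hpos ?_
  rw [← h1]
  rw [← hcard] at h2
  rw [← h2]
  obtain ⟨e, he⟩ := h
  refine Fintype.sum_equiv e _ _ fun s => ?_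
  obtain ⟨f⟩ := he s
  rw [card_filter_cycleSets (K := G.induce (↑s.1 : Set V)) (Embedding.induce _) s.1 (by
      ext z; simp),
    card_filter_cycleSets (K := G.induce (↑s.1 : Set V))
      ((Embedding.induce _).comp f.toEmbedding) (e s).1 ?_]
  ext z
  constructor
  · rintro ⟨y, rfl⟩
    exact (f y).2
  · intro hz
    exact ⟨f.symm ⟨z, hz⟩, by simp⟩

end Deck

/-! ### Configurations -/

/-- `K` has a mate, and both have the same number of `g`-cycles and no shorter cycles. -/
structure Bad [Fintype V] (g : ℕ) (K : SimpleGraph V) : Prop where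
  five_le : 5 ≤ g
  girth : GirthGE g K
  exists_mate : ∃ L : SimpleGraph V, Mate K L ∧ GirthGE g L ∧
    (cycleSets g K).card = (cycleSets g L).card

section Bad

variable [Fintype V] {g : ℕ} {K : SimpleGraph V}

lemma Bad.cubic (h : Bad g K) : Cubic K := by
  obtain ⟨L, hL, -⟩ := h.exists_mate
  exact hL.cubic_left

lemma Bad.no_triangle (h : Bad g K) {x y z : V} (hxy : K.Adj x y) (hxz : K.Adj x z)
    (hyz : K.Adj y z) : False := by
  obtain ⟨L, hL, -⟩ := h.exists_mate
  exact hL.no_triangle hxy hxz hyz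

lemma Bad.exists_switch (h : Bad g K) {x y : V} (hxy : x ≠ y)
    (hnear : K.Adj x y ∨ ∃ z, K.Adj x z ∧ K.Adj y z) {a : V} (ha : K.Adj x a) (hay : a ≠ y)
    (hya : ¬ K.Adj y a) :
    ∃ c, K.Adj y c ∧ c ≠ x ∧ ¬ K.Adj x c ∧ ∃ M : SimpleGraph V, Bad g M ∧
      (cycleSets g M).card = (cycleSets g K).card ∧
      AgreeOff K M {x, y} ∧ (M.Adj x y ↔ K.Adj x y) ∧
      (∀ u, u ≠ x → u ≠ y → (M.Adj x u ↔ (K.Adj x u ∧ u ≠ a) ∨ u = c)) ∧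
      (∀ u, u ≠ x → u ≠ y → (M.Adj y u ↔ (K.Adj y u ∧ u ≠ c) ∨ u = a)) := by
  classical
  obtain ⟨L, hL, hgL, hcard⟩ := h.exists_mate
  obtain ⟨M, ⟨m⟩, hKM⟩ := hL.left x y hxy
  obtain ⟨c, hc, hcx, hxc, N, ⟨n⟩, hKN, hadj, hx, hy⟩ := hKM.exists_switch hL.cubic_left
    (hL.cubic_right.of_iso m) hxy (fun ⟨e⟩ => hL.not_iso ⟨e.trans m⟩) hnear ha hay hya
  have hcN : (cycleSets g N).card = (cycleSets g K).card := by
    rw [hcard]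
    exact card_cycleSets_of_iso (n.trans m)
  exact ⟨c, hc, hcx, hxc, N, ⟨h.five_le, hgL.of_embedding (Iso.toEmbedding (n.trans m)), K,
    (hL.trans_iso (n.trans m).symm).symm, h.girth, hcN⟩, hcN, hKN, hadj, hx, hy⟩

omit [Fintype V] in
/-- A `g`-cycle has no chords. -/
lemma GirthGE.eq_or_eq_of_adj (hg : GirthGE g K) {x a b : V} (p : K.Walk a b) (hxa : K.Adj x a)
    (hl : p.length + 2 ≤ g) (hx : x ∉ p.support) {u : V} (hu : u ∈ p.support)
    (hxu : K.Adj x u) : u = a ∨ u = b := by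
  classical
  by_contra! hne
  have h1 := hg.le_length hxa hxu hne.1.symm (p.takeUntil u hu)
    fun h => hx (p.support_takeUntil_subset_support hu h)
  have h2 := p.length_takeUntil_lt_length hu hne.2
  omega

lemma exists_adj_notMem (hK : Cubic K) (hg : GirthGE g K) {S : Finset V}
    (hS : S ∈ cycleSets g K) {x : V} (hx : x ∈ S) : ∃ w, K.Adj x w ∧ w ∉ S := by
  classical
  obtain ⟨a, b, p, hxa, hxb, hab, -, hl, hxp, hSp⟩ := exists_arc_of_mem_cycleSets hg hS hx
  obtain ⟨w, hw⟩ : (((nbr K x).erase a).erase b).Nonempty := by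
    rw [← card_pos, card_erase_of_mem (by simp [hxb, hab.symm]),
      card_erase_of_mem (by simp [hxa]), hK]
    norm_num
  simp only [mem_erase, mem_nbr] at hw
  refine ⟨w, hw.2.2, fun hwS => ?_⟩
  rcases (hSp w).1 hwS with rfl | hwp
  · exact K.loopless.irrefl _ hw.2.2
  · rcases hg.eq_or_eq_of_adj p hxa hl.le hxp hwp hw.2.2 with rfl | rfl
    · exact hw.2.1 rfl
    · exact hw.1 rfl

lemma Mate.add_two_le_card {L : SimpleGraph W} [Fintype W] (h : Mate K L) (hg : GirthGE g K)
    {S : Finset V} (hS : S ∈ cycleSets g K) : g + 2 ≤ Fintype.card V := by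
  classical
  obtain ⟨x, hx⟩ : S.Nonempty := by
    obtain ⟨-, u, p, -, hp⟩ := mem_cycleSets.1 hS
    exact ⟨u, hp u p.start_mem_support⟩
  obtain ⟨a, b, p, hxa, -, -, -, -, -, hSp⟩ := exists_arc_of_mem_cycleSets hg hS hx
  have ha : a ∈ S := (hSp a).2 (Or.inr p.start_mem_support)
  obtain ⟨w, hxw, hw⟩ := exists_adj_notMem h.cubic_left hg hS hx
  obtain ⟨w', haw', hw'⟩ := exists_adj_notMem h.cubic_left hg hS ha
  have hne : w ≠ w' := by
    rintro rfl
    exact h.no_triangle hxa hxw haw'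
  have := card_le_univ (insert w (insert w' S))
  rw [card_insert_of_notMem (by simp [hne, hw]), card_insert_of_notMem hw',
    (mem_cycleSets.1 hS).1] at this
  exact this

omit [Fintype V] in
lemma CardRel.girthGE [Fintype W] {L : SimpleGraph W} (h : CardRel L K) (hg : GirthGE g K)
    (hcard : g + 2 ≤ Fintype.card W) : GirthGE g L := by
  classical
  intro S hS
  by_contra! hlt
  have hc : 1 < Sᶜ.card := by
    rw [card_compl]
    omega
  obtain ⟨x, hx, y, hy, hxy⟩ := one_lt_card.1 hc
  rw [mem_compl] at hx hy
  obtain ⟨M, ⟨m⟩, hM⟩ := h x y hxy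
  have hSM : HasCycleOn M S := by
    refine hS.congr fun u hu v hv => (hM u ?_ v ?_).1 <;>
    · simp only [Set.mem_insert_iff, Set.mem_singleton_iff]
      rintro (rfl | rfl) <;> simp_all
  have := hg.of_embedding m.toEmbedding S hSM
  omega

lemma _root_.SameDeck.bad [DecidableEq V] [Fintype W] [DecidableEq W] {H : SimpleGraph W}
    (hK : Cubic K) (hH : Cubic H) (hcard : Fintype.card V = Fintype.card W)
    (hdeck : SameDeck K H (Fintype.card V - 2)) (hniso : ¬ Nonempty (K ≃g H))
    (hg : GirthGE g K) {S : Finset V} (hS : S ∈ cycleSets g K) : Bad g K := by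
  have hmate : Mate K H :=
    ⟨hK, hH, hdeck.cardRel hcard, SameDeck.cardRel hcard.symm (hcard ▸ hdeck.symm), hniso⟩
  have hn := hmate.add_two_le_card hg hS
  have hgH : GirthGE g H := hmate.right.girthGE hg (hcard ▸ hn)
  let e := Fintype.equivOfCardEq hcard
  have f : H.comap e ≃g H := Iso.comap e H
  refine ⟨hmate.five_le hg hS, hg, H.comap e, hmate.trans_iso f.symm,
    hgH.of_embedding f.toEmbedding, ?_⟩
  rw [card_cycleSets_of_iso f]
  exact hdeck.card_cycleSets hcard hn

end Bad

/-! ### Frames -/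

/-- An enumeration `v` of a cycle in cyclic order, together with a neighbour `w i` of each
`v i` outside the cycle. -/
structure Frame {g : ℕ} (K : SimpleGraph V) (v w : ZMod g → V) : Prop where
  inj : Function.Injective v
  adj : ∀ i, K.Adj (v i) (v (i + 1))
  off : ∀ i, w i ∉ Set.range v
  spoke : ∀ i, K.Adj (v i) (w i)

lemma natCast_ne_zero {g k : ℕ} (hk : 0 < k) (hkg : k < g) : (k : ZMod g) ≠ 0 := by
  rw [Ne, ZMod.natCast_eq_zero_iff]
  exact fun h => absurd (Nat.le_of_dvd hk h) (by omega)

lemma exists_frame [Fintype V] {g : ℕ} [NeZero g] {K : SimpleGraph V} (h : Bad g K)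
    {S : Finset V} (hS : S ∈ cycleSets g K) :
    ∃ v w : ZMod g → V, Frame K v w ∧ Set.range v = S := by
  classical
  obtain ⟨x, hx⟩ : S.Nonempty := by
    obtain ⟨-, u, p, -, hp⟩ := mem_cycleSets.1 hS
    exact ⟨u, hp u p.start_mem_support⟩
  obtain ⟨p, hp, hl, hpS⟩ := exists_cycle_of_mem_cycleSets h.girth hS hx
  have h5 := h.five_le
  let v : ZMod g → V := fun i => p.getVert i.val
  have hv : Set.range v = S := by
    ext z
    rw [← hpS, mem_coe, List.mem_toFinset, Walk.mem_support_iff_exists_getVert]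
    constructor
    · rintro ⟨i, rfl⟩
      exact ⟨i.val, rfl, by rw [hl]; exact (ZMod.val_lt i).le⟩
    · rintro ⟨n, rfl, hn⟩
      rcases (hl ▸ hn).lt_or_eq with hlt | rfl
      · exact ⟨n, by simp [v, ZMod.val_natCast, Nat.mod_eq_of_lt hlt]⟩
      · exact ⟨0, by simp [v, ← hl]⟩
  have hmem : ∀ i, v i ∈ S := fun i => by
    rw [← mem_coe, ← hv]
    exact ⟨i, rfl⟩
  choose w hw hwS using fun i => exists_adj_notMem h.cubic h.girth hS (hmem i)
  refine ⟨v, w, ⟨?_, ?_, ?_, hw⟩, hv⟩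
  · intro i j hij
    apply ZMod.val_injective
    have hi := ZMod.val_lt i
    have hj := ZMod.val_lt j
    exact hp.getVert_injOn' (by simp; omega) (by simp; omega) hij
  · intro i
    have hi := ZMod.val_lt i
    have hadj := p.adj_getVert_succ (i := i.val) (by omega)
    suffices v (i + 1) = p.getVert (i.val + 1) by rwa [this]
    have : Fact (1 < g) := ⟨by omega⟩
    rcases (Nat.succ_le_of_lt hi).lt_or_eq with hlt | heq
    · simp only [v]
      rw [ZMod.val_add_of_lt (by rw [ZMod.val_one]; exact hlt), ZMod.val_one]
    · have h0 : i + 1 = 0 := by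
        have := congrArg (Nat.cast : ℕ → ZMod g) heq
        simpa using this
      simp only [v]
      rw [h0, ZMod.val_zero, Walk.getVert_zero, ← Nat.succ_eq_add_one, heq, ← hl,
        Walk.getVert_length]
  · intro i
    rw [hv]
    exact_mod_cast hwS i

namespace Frame

variable {g : ℕ} {K : SimpleGraph V} {v w : ZMod g → V}

lemma linked_arc (F : Frame K v w) {X : Set V} (i : ZMod g) (n : ℕ)
    (hX : ∀ k ≤ n, v (i + k) ∉ X) : Linked K X n (v i) (v (i + n)) := by
  induction n generalizing i with
  | zero => exact ⟨Walk.nil.copy rfl (by simp), by simp, by simpa using hX 0 le_rfl⟩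
  | succ n ih =>
    have h1 := ih (i + 1) fun k hk => by
      have := hX (k + 1) (by omega)
      push_cast at this
      rwa [add_assoc, add_comm (1 : ZMod g)]
    have h2 := h1.cons (F.adj i) (by simpa using hX 0 (Nat.zero_le _))
    push_cast
    rwa [add_comm (n : ZMod g), ← add_assoc]

variable [Fintype V] (h5 : 5 ≤ g)

include h5

lemma adj_iff (F : Frame K v w) (hK : Cubic K) (i : ZMod g) (u : V) :
    K.Adj (v i) u ↔ u = v (i + 1) ∨ u = v (i - 1) ∨ u = w i := by
  classical
  have h2 : i + 1 ≠ i - 1 := by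
    intro h
    apply natCast_ne_zero (g := g) (k := 2) (by omega) (by omega)
    push_cast
    linear_combination h
  have hm : K.Adj (v i) (v (i - 1)) := by
    have := F.adj (i - 1)
    rw [sub_add_cancel] at this
    exact this.symm
  have hsub : ({v (i + 1), v (i - 1), w i} : Finset V) ⊆ nbr K (v i) := by
    intro z
    simp only [mem_insert, mem_singleton, mem_nbr]
    rintro (rfl | rfl | rfl)
    · exact F.adj i
    · exact hm
    · exact F.spoke i
  have heq := eq_of_subset_of_card_le hsub (by
    rw [hK, card_insert_of_notMem, card_pair]
    · exact fun h => F.off i ⟨_, h⟩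
    · simp only [mem_insert, mem_singleton, not_or]
      exact ⟨fun h => h2 (F.inj h), fun h => F.off i ⟨_, h⟩⟩)
  rw [← mem_nbr, ← heq]
  simp

lemma exists_swap (F : Frame K v w) (h : Bad g K) (i : ZMod g) :
    ∃ M : SimpleGraph V, Bad g M ∧ (cycleSets g M).card = (cycleSets g K).card ∧
      AgreeOff K M {v i, v (i + 1)} ∧ Frame M v (w ∘ Equiv.swap i (i + 1)) := by
  have hnz : ∀ k : ℕ, 0 < k → k < 5 → (k : ZMod g) ≠ 0 := fun k hk hk' =>
    natCast_ne_zero hk (by omega)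
  have n1 := hnz 1 (by omega) (by omega)
  have n2 := hnz 2 (by omega) (by omega)
  have n3 := hnz 3 (by omega) (by omega)
  push_cast at n1 n2 n3
  have hA := F.adj_iff h5 h.cubic
  have hvw : ∀ i j, v i ≠ w j := fun i j h => F.off j ⟨i, h⟩
  have hinj : ∀ i j, v i = v j ↔ i = j := fun i j => F.inj.eq_iff
  have hwi : ¬ K.Adj (v (i + 1)) (w i) := fun hadj => h.no_triangle (F.adj i) (F.spoke i) hadj
  obtain ⟨c, hc, hcx, -, M, hM, hcard, hKM, hadj, hx, hy⟩ := h.exists_switch (F.adj i).ne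
    (Or.inl (F.adj i)) (F.spoke i) (hvw _ _).symm hwi
  have hcw : c = w (i + 1) := by
    rcases (hA _ _).1 hc with hc' | hc' | hc'
    · exfalso
      have e1 : M.Adj (v i) c := (hx c hcx hc.ne').2 (Or.inr rfl)
      have e2 : M.Adj (v i) (v (i - 1)) := by
        refine (hx _ ?_ ?_).2 (Or.inl ⟨(hA _ _).2 (by simp), hvw _ _⟩)
        · rw [Ne, hinj]
          intro h; apply n1; linear_combination -h
        · rw [Ne, hinj]
          intro h; apply n2; linear_combination -h
      have hcast : ((g - 3 : ℕ) : ZMod g) = -3 := by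
        rw [Nat.cast_sub (by omega)]
        simp
      have harc := F.linked_arc (X := {v i, v (i + 1)}) (i + 1 + 1) (g - 3) (by
        intro k hk hmem
        simp only [Set.mem_insert_iff, Set.mem_singleton_iff, hinj] at hmem
        rcases hmem with hmem | hmem
        · apply natCast_ne_zero (g := g) (k := k + 2) (by omega) (by omega)
          push_cast
          linear_combination hmem
        · apply natCast_ne_zero (g := g) (k := k + 1) (by omega) (by omega)
          push_cast
          linear_combination hmem)
      rw [hcast, show i + 1 + 1 + (-3 : ZMod g) = i - 1 by ring, ← hc'] at harc
      have hlink := (hKM.linked harc subset_rfl).mono (Y := {v i}) (by simp) le_rfl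
      have := hM.girth.le_of_linked e1 e2 (by
        rw [hc', Ne, hinj]
        intro h; apply n3; linear_combination h) hlink
      omega
    · exact absurd (by rw [hc', add_sub_cancel_right]) hcx
    · exact hc'
  subst hcw
  have hmadj : ∀ j u, j ≠ i → j ≠ i + 1 → u ≠ v i → u ≠ v (i + 1) → K.Adj (v j) u →
      M.Adj (v j) u := by
    intro j u hj hj' hu hu' hju
    exact (hKM _ (by simp [hinj, hj, hj']) _ (by simp [hu, hu'])).1 hju
  refine ⟨M, hM, hcard, hKM, F.inj, ?_, fun j => F.off _, ?_⟩
  · intro j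
    by_cases hj : j = i
    · subst hj
      exact hadj.2 (F.adj j)
    by_cases hj1 : j = i + 1
    · subst hj1
      refine (hy _ ?_ (F.adj _).ne').2 (Or.inl ⟨F.adj _, hvw _ _⟩)
      rw [Ne, hinj]
      intro h; apply n2; linear_combination h
    by_cases hj2 : j + 1 = i
    · rw [hj2]
      refine ((hx _ ?_ ?_).2 (Or.inl ⟨?_, hvw _ _⟩)).symm
      · rwa [Ne, hinj]
      · rwa [Ne, hinj]
      · rw [← hj2]
        exact (F.adj j).symm
    · refine hmadj j _ hj hj1 ?_ ?_ (F.adj j)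
      · rwa [Ne, hinj]
      · rw [Ne, hinj]
        exact fun h => hj (add_right_cancel h)
  · intro j
    by_cases hj : j = i
    · subst hj
      simp only [Function.comp_apply, Equiv.swap_apply_left]
      exact (hx _ (hvw _ _).symm (hvw _ _).symm).2 (Or.inr rfl)
    by_cases hj1 : j = i + 1
    · subst hj1
      simp only [Function.comp_apply, Equiv.swap_apply_right]
      exact (hy _ (hvw _ _).symm (hvw _ _).symm).2 (Or.inr rfl)
    rw [Function.comp_apply, Equiv.swap_apply_of_ne_of_ne hj hj1]
    exact hmadj j _ hj hj1 (hvw _ _).symm (hvw _ _).symm (F.spoke j)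

omit h5 [Fintype V] in
lemma _root_.CubicDeck.closure_swap_add_one (g : ℕ) [NeZero g] :
    Submonoid.closure (Set.range fun i : ZMod g => Equiv.swap i (i + 1)) = ⊤ := by
  obtain ⟨m, rfl⟩ := Nat.exists_eq_succ_of_ne_zero (NeZero.ne g)
  have h : (⊤ : Submonoid (Equiv.Perm (Fin (m + 1)))) ≤
      Submonoid.closure (Set.range fun i : Fin (m + 1) => Equiv.swap i (i + 1)) := by
    rw [← Equiv.Perm.mclosure_swap_castSucc_succ m]
    apply Submonoid.closure_mono
    rintro _ ⟨i, rfl⟩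
    refine ⟨i.castSucc, ?_⟩
    simp only
    rw [Fin.coeSucc_eq_succ]
  exact eq_top_iff.2 h

lemma exists_arrange (F : Frame K v w) (h : Bad g K) (σ : Equiv.Perm (ZMod g)) :
    ∃ M : SimpleGraph V, Bad g M ∧ (cycleSets g M).card = (cycleSets g K).card ∧
      AgreeOff K M (Set.range v) ∧ Frame M v (w ∘ σ) := by
  have : NeZero g := ⟨by omega⟩
  have hσ : σ ∈ Submonoid.closure (Set.range fun i : ZMod g => Equiv.swap i (i + 1)) := by
    rw [closure_swap_add_one]
    trivial
  induction hσ using Submonoid.closure_induction_right with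
  | one => exact ⟨K, h, rfl, fun _ _ _ _ => Iff.rfl, F⟩
  | mul_right σ hσ τ hτ ih =>
    obtain ⟨i, rfl⟩ := hτ
    obtain ⟨M, hM, hc, hKM, FM⟩ := ih
    obtain ⟨N, hN, hc', hMN, FN⟩ := FM.exists_swap h5 hM i
    refine ⟨N, hN, hc'.trans hc, hKM.trans (hMN.mono ?_), FN⟩
    rintro _ (rfl | rfl)
    · exact ⟨_, rfl⟩
    · exact ⟨_, rfl⟩

end Frame

/-! ### Links between the spokes of a frame -/

lemma exists_perm {g n : ℕ} (hn : n ≤ g) (f : Fin n → ZMod g) (hf : Function.Injective f) :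
    ∃ σ : Equiv.Perm (ZMod g), ∀ k : Fin n, σ ((k : ℕ) : ZMod g) = f k := by
  have hinj : Function.Injective fun k : Fin n => ((k : ℕ) : ZMod g) := by
    intro a b hab
    have ha := ZMod.val_natCast_of_lt (a.2.trans_le hn)
    have hb := ZMod.val_natCast_of_lt (b.2.trans_le hn)
    simp only at hab
    rw [hab, hb] at ha
    exact Fin.ext ha.symm
  exact Equiv.Perm.exists_extending_pair _ f hinj hf

lemma exists_perm_two {g : ℕ} (h5 : 5 ≤ g) {i j : ZMod g} (hij : i ≠ j) :
    ∃ σ : Equiv.Perm (ZMod g), σ 0 = i ∧ σ 1 = j := by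
  obtain ⟨σ, hσ⟩ := exists_perm (n := 2) (by omega) ![i, j] (by
    intro a b hab
    fin_cases a <;> fin_cases b <;> simp_all)
  exact ⟨σ, by simpa using hσ 0, by simpa using hσ 1⟩

lemma exists_perm_three {g : ℕ} (h5 : 5 ≤ g) {i j k : ZMod g} (hij : i ≠ j) (hik : i ≠ k)
    (hjk : j ≠ k) : ∃ σ : Equiv.Perm (ZMod g), σ 0 = i ∧ σ 1 = j ∧ σ 2 = k := by
  obtain ⟨σ, hσ⟩ := exists_perm (n := 3) (by omega) ![i, j, k] (by
    intro a b hab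
    fin_cases a <;> fin_cases b <;> simp_all)
  exact ⟨σ, by simpa using hσ 0, by simpa using hσ 1, by simpa using hσ 2⟩

lemma exists_perm_four {g : ℕ} (h5 : 5 ≤ g) {i j k l : ZMod g} (hij : i ≠ j) (hik : i ≠ k)
    (hil : i ≠ l) (hjk : j ≠ k) (hjl : j ≠ l) (hkl : k ≠ l) :
    ∃ σ : Equiv.Perm (ZMod g), σ 0 = i ∧ σ 1 = j ∧ σ 2 = k ∧ σ 3 = l := by
  obtain ⟨σ, hσ⟩ := exists_perm (n := 4) (by omega) ![i, j, k, l] (by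
    intro a b hab
    fin_cases a <;> fin_cases b <;> simp_all)
  exact ⟨σ, by simpa using hσ 0, by simpa using hσ 1, by simpa using hσ 2, by simpa using hσ 3⟩

lemma eq_or_eq_or_eq_of_card_le_two {s : Finset V} (hs : s.card ≤ 2) {a b c : V} (ha : a ∈ s)
    (hb : b ∈ s) (hc : c ∈ s) : a = b ∨ a = c ∨ b = c := by
  by_contra! h
  have := two_lt_card.2 ⟨a, ha, b, hb, c, hc, h.1, h.2.1, h.2.2⟩
  omega

lemma Cubic.eq_or_eq_or_eq [Fintype V] {K : SimpleGraph V} (hK : Cubic K) {z p a b c : V}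
    (hp : K.Adj z p) (ha : K.Adj z a) (hb : K.Adj z b) (hc : K.Adj z c) (hap : a ≠ p)
    (hbp : b ≠ p) (hcp : c ≠ p) : a = b ∨ a = c ∨ b = c := by
  classical
  have hs : ((nbr K z).erase p).card ≤ 2 := by
    rw [card_erase_of_mem (by simpa using hp), hK]
  exact eq_or_eq_or_eq_of_card_le_two hs (by simp [hap, ha]) (by simp [hbp, hb])
    (by simp [hcp, hc])

namespace Frame

variable {g : ℕ} {K : SimpleGraph V} {v w : ZMod g → V}

lemma v_ne_w (F : Frame K v w) (i j : ZMod g) : v i ≠ w j := fun h => F.off j ⟨i, h⟩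

variable [Fintype V]

lemma eq_spoke (F : Frame K v w) (h : Bad g K) {i : ZMod g} {u : V} (hu : K.Adj (v i) u)
    (hur : u ∉ Set.range v) : u = w i := by
  rcases (F.adj_iff h.five_le h.cubic i u).1 hu with rfl | rfl | rfl
  · exact absurd ⟨_, rfl⟩ hur
  · exact absurd ⟨_, rfl⟩ hur
  · rfl

lemma le_of_linked (F : Frame K v w) (h : Bad g K) {i j : ZMod g} (hij : i ≠ j) {k : ℕ}
    (hl : Linked K (Set.range v) k (w i) (w j)) : g ≤ k + 3 := by
  obtain ⟨σ, h0, h1⟩ := exists_perm_two h.five_le hij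
  obtain ⟨M, hM, -, hKM, FM⟩ := F.exists_arrange h.five_le h σ
  have hl' := hKM.linked hl subset_rfl
  rw [← h0, ← h1] at hl'
  have hadj := FM.adj 0
  rw [zero_add] at hadj
  have hlink := ((hl'.mono (Y := {v 0}) (by simp) le_rfl).symm.cons (FM.spoke 1)
    (by simpa using hadj.ne'))
  have := hM.girth.le_of_linked hadj (FM.spoke 0) (FM.v_ne_w _ _) hlink
  omega

lemma inj_spoke (F : Frame K v w) (h : Bad g K) : Function.Injective w := by
  intro i j hij
  by_contra hne
  have := F.le_of_linked h hne (k := 0) ⟨Walk.nil.copy rfl hij, by simp, by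
    intro z hz
    simp only [Walk.support_copy, Walk.support_nil, List.mem_singleton] at hz
    rw [hz]
    exact F.off i⟩
  have := h.five_le
  omega

lemma mem_cycleSets (F : Frame K v w) (h : Bad g K) {i : ZMod g} {a b : V} (ha : a = w i)
    (hb : b = w (i + 1)) (q : K.Walk a b) (hq : q.length + 3 ≤ g)
    (hqv : ∀ z ∈ q.support, z ∉ Set.range v) {S : Finset V}
    (hS : ∀ z, z ∈ S ↔ z = v i ∨ z = v (i + 1) ∨ z ∈ q.support) : S ∈ cycleSets g K := by
  classical
  subst ha
  subst hb
  have hcyc : HasCycleOn K (S : Set V) := by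
    refine hasCycleOn_of_walk (F.adj i) (F.spoke i) (F.v_ne_w _ _)
      (Walk.cons (F.spoke (i + 1)) q.reverse) ?_ ?_ ?_
    · simp only [Walk.support_cons, Walk.support_reverse, List.mem_cons, List.mem_reverse]
      rintro (h | h)
      · exact (F.adj i).ne h
      · exact hqv _ h ⟨_, rfl⟩
    · simp [hS]
    · intro z
      simp only [Walk.support_cons, Walk.support_reverse, List.mem_cons, List.mem_reverse,
        mem_coe, hS]
      tauto
  refine CubicDeck.mem_cycleSets.2 ⟨le_antisymm ?_ (h.girth S hcyc), hcyc⟩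
  have hSq : S = insert (v i) (insert (v (i + 1)) q.support.toFinset) := by
    ext z
    simp [hS]
  have h1 := card_insert_le (v i) (insert (v (i + 1)) q.support.toFinset)
  have h2 := card_insert_le (v (i + 1)) q.support.toFinset
  have h3 := card_support_toFinset_le q
  rw [hSq]
  omega

/-- A second `g`-cycle meeting the cycle of a frame runs along exactly one of its edges. -/
lemma exists_walk_of_mem_cycleSets (F : Frame K v w) (h : Bad g K) {S : Finset V}
    (hS : S ∈ cycleSets g K) (hne : (S : Set V) ≠ Set.range v) {i₀ : ZMod g} (hi₀ : v i₀ ∈ S) :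
    ∃ (i : ZMod g) (q : K.Walk (w i) (w (i + 1))), q.length + 3 ≤ g ∧
      (∀ z ∈ q.support, z ∉ Set.range v) ∧
      ∀ z, z ∈ S ↔ z = v i ∨ z = v (i + 1) ∨ z ∈ q.support := by
  classical
  have h5 := h.five_le
  have : NeZero g := ⟨by omega⟩
  obtain ⟨o, hoS, ho⟩ : ∃ o ∈ S, o ∉ Set.range v := by
    by_contra! hsub
    apply hne
    have hsub' : S ⊆ univ.image v := fun z hz => by simpa using hsub z hz
    rw [eq_of_subset_of_card_le hsub' (by
      rw [card_image_of_injective _ F.inj, (CubicDeck.mem_cycleSets.1 hS).1, card_univ,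
        ZMod.card])]
    simp
  obtain ⟨c, hc, -, hcS⟩ := exists_cycle_of_mem_cycleSets h.girth hS hi₀
  have hmemc : ∀ z, z ∈ c.support ↔ z ∈ S := fun z => by rw [← hcS]; simp
  obtain ⟨u, s, q, hus, r, hs, hq, hcq⟩ := exists_first_hit (Set.range v)ᶜ
    (c.takeUntil o ((hmemc o).2 hoS)) (by simp) ho
  have hsubS : ∀ z ∈ (q.append (Walk.cons hus r)).support, z ∈ S := by
    intro z hz
    rw [← hcq] at hz
    exact (hmemc z).1 (c.support_takeUntil_subset_support _ hz)
  obtain ⟨i, rfl⟩ : u ∈ Set.range v := by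
    have := hq u q.end_mem_support
    simpa using this
  have hsi := F.eq_spoke h hus hs
  have hiS : v i ∈ S := hsubS _ (by simp)
  have hwS : w i ∈ S := hsubS _ (by simp [← hsi])
  clear hcq hsubS hq hs hsi hus hmemc hcS hc q r c
  obtain ⟨b, p, hb, hbw, hl, hvp, hSp⟩ : ∃ (b : V) (p : K.Walk (w i) b), K.Adj (v i) b ∧
      w i ≠ b ∧ p.length + 2 = g ∧ v i ∉ p.support ∧ ∀ z, z ∈ S ↔ z = v i ∨ z ∈ p.support := by
    obtain ⟨a, b, p, hxa, hxb, hab, -, hl, hxp, hSp⟩ := exists_arc_of_mem_cycleSets h.girth hS hiS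
    have hwp : w i ∈ p.support := ((hSp _).1 hwS).resolve_left (F.v_ne_w _ _).symm
    rcases h.girth.eq_or_eq_of_adj p hxa hl.le hxp hwp (F.spoke i) with rfl | rfl
    · exact ⟨b, p, hxb, hab, hl, hxp, hSp⟩
    · exact ⟨a, p.reverse, hxa, hab.symm, by simpa using hl, by simpa using hxp, by simpa using hSp⟩
  have hbv : b ∈ Set.range v := by
    by_contra hb'
    exact hbw (F.eq_spoke h hb hb').symm
  obtain ⟨u, s, q, hus, r, ⟨j, rfl⟩, hq, hpq⟩ := exists_first_hit (Set.range v) p (F.off i) hbv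
  have hu : u = w j := F.eq_spoke h hus.symm (hq u q.end_mem_support)
  subst hu
  have hji : j ≠ i := by
    rintro rfl
    apply hvp
    rw [hpq]
    simp
  have hqlen := F.le_of_linked h hji.symm ⟨q, le_rfl, hq⟩
  have hlen := congrArg Walk.length hpq
  rw [Walk.length_append, Walk.length_cons] at hlen
  have hr : r.length = 0 := by omega
  have hjb : v j = b := Walk.eq_of_length_eq_zero hr
  subst hjb
  have hmem : ∀ z, z ∈ S ↔ z = v i ∨ z = v j ∨ z ∈ q.support := by
    intro z
    have hr' : z ∈ r.support ↔ z = v j := by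
      cases r with
      | nil => simp
      | cons => simp at hr
    have := q.end_mem_support
    rw [hSp, hpq, Walk.mem_support_append_iff, Walk.support_cons, List.mem_cons, hr']
    grind
  rcases (F.adj_iff h5 h.cubic i _).1 hb with hj | hj | hj
  · obtain rfl := F.inj hj
    exact ⟨i, q, by omega, hq, hmem⟩
  · obtain rfl := F.inj hj
    refine ⟨i - 1, q.reverse.copy rfl (by rw [sub_add_cancel]), by simp; omega, by simpa using hq,
      fun z => ?_⟩
    simp only [Walk.support_copy, Walk.support_reverse, List.mem_reverse]
    rw [hmem, sub_add_cancel]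
    tauto
  · exact absurd hj (F.v_ne_w _ _)

end Frame

namespace Frame

variable {g : ℕ} {K : SimpleGraph V} {v w : ZMod g → V}

lemma hasCycleOn (F : Frame K v w) (h5 : 5 ≤ g) : HasCycleOn K (Set.range v) := by
  have hk : ∀ k ≤ g - 2, v (1 + (k : ZMod g)) ∉ (Set.range v)ᶜ ∪ {v 0} := by
    rintro k hk (h | h)
    · exact h ⟨_, rfl⟩
    · apply natCast_ne_zero (g := g) (k := k + 1) (by omega) (by omega)
      push_cast
      rw [add_comm]
      exact F.inj h
  obtain ⟨p, -, hp⟩ := F.linked_arc 1 (g - 2) hk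
  have hend : 1 + ((g - 2 : ℕ) : ZMod g) + 1 = 0 := by
    rw [Nat.cast_sub (by omega), CharP.cast_eq_zero]
    push_cast
    ring
  have h0 := F.adj 0
  have h1 := F.adj (1 + ((g - 2 : ℕ) : ZMod g))
  rw [zero_add] at h0
  rw [hend] at h1
  refine hasCycleOn_of_walk h0 h1.symm (fun h => ?_) p (fun h => hp _ h (Or.inr rfl)) ⟨_, rfl⟩
    fun z hz => ?_
  · apply natCast_ne_zero (g := g) (k := g - 2) (by omega) (by omega)
    simpa using F.inj h
  · by_contra hzv
    exact hp z hz (Or.inl hzv)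

variable [Fintype V]

lemma range_mem_cycleSets [NeZero g] (F : Frame K v w) (h : Bad g K) {S : Finset V}
    (hS : (S : Set V) = Set.range v) : S ∈ cycleSets g K := by
  classical
  refine CubicDeck.mem_cycleSets.2 ⟨?_, hS ▸ F.hasCycleOn h.five_le⟩
  have : S = univ.image v := by
    rw [← coe_inj, hS]
    simp
  rw [this, card_image_of_injective _ F.inj, card_univ, ZMod.card]

/-- No vertex near the spoke `w i` has an outgoing edge leading to short paths to two further
spokes. -/
lemma false_of_branch (F : Frame K v w) (h : Bad g K) {i j j' : ZMod g} (hij : j ≠ i)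
    (hij' : j' ≠ i) (hjj' : j ≠ j') {z t : V} (hz : z ∉ Set.range v)
    (hzi : z = w i ∨ K.Adj z (w i)) (hzt : K.Adj z t) (ht : t ∉ Set.range v) (hti : t ≠ w i)
    (hj : Linked K (Set.range v ∪ {z}) (g - 4) t (w j))
    (hj' : Linked K (Set.range v ∪ {z}) (g - 4) t (w j')) : False := by
  have h5 := h.five_le
  obtain ⟨σ, h0, h1, h2⟩ := exists_perm_three h5 hij hjj' hij'.symm
  obtain ⟨M, hM, -, hKM, FM⟩ := F.exists_arrange h5 h σ
  have hw1 : (w ∘ σ) 1 = w i := congrArg w h1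
  have hz1 : z ≠ v 1 := fun h => hz ⟨_, h.symm⟩
  have ht1 : t ≠ v 1 := fun h => ht ⟨_, h.symm⟩
  have hzi' : z = w i ∨ M.Adj z (w i) := hzi.imp_right (hKM z hz _ (F.off i)).1
  have hsp : M.Adj (v 1) (w i) := hw1 ▸ FM.spoke 1
  have hnear : M.Adj z (v 1) ∨ ∃ u, M.Adj z u ∧ M.Adj (v 1) u := by
    rcases hzi' with rfl | hzi'
    · exact Or.inl hsp.symm
    · exact Or.inr ⟨_, hzi', hsp⟩
  have hA := FM.adj_iff h5 hM.cubic 1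
  rw [hw1] at hA
  have hyt : ¬ M.Adj (v 1) t := by
    rw [hA]
    rintro (h | h | h)
    · exact ht ⟨_, h.symm⟩
    · exact ht ⟨_, h.symm⟩
    · exact hti h
  obtain ⟨c, hc, hcz, hzc, N, hN, -, hMN, -, -, hN1⟩ :=
    hM.exists_switch hz1 hnear ((hKM z hz t ht).1 hzt) ht1 hyt
  have key : ∀ k : ZMod g, M.Adj (v 1) (v k) → v k ≠ c →
      Linked K (Set.range v ∪ {z}) (g - 4) t (w (σ k)) → False := by
    intro k hk hkc hl
    have hkz : v k ≠ z := fun h => hz ⟨_, h⟩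
    have hwz : w (σ k) ≠ z := fun h => hl.right_notMem (Or.inr h)
    have hl2 : Linked N (Set.range v ∪ {z}) (g - 4) t (w (σ k)) :=
      hMN.linked (hKM.linked hl Set.subset_union_left) (by
        rintro u (rfl | rfl)
        · exact Or.inr rfl
        · exact Or.inl ⟨_, rfl⟩)
    have hs : N.Adj (v k) (w (σ k)) :=
      (hMN _ (by simp [hkz, hk.ne']) _ (by simp [hwz, (F.v_ne_w _ _).symm])).1 (FM.spoke k)
    have hl3 := (hl2.mono (Y := {v 1}) (by
      rintro u rfl
      exact Or.inl ⟨_, rfl⟩) le_rfl).symm.cons hs (by simpa using hk.ne')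
    have := hN.girth.le_of_linked ((hN1 _ hkz hk.ne').2 (Or.inl ⟨hk, hkc⟩))
      ((hN1 t hzt.ne' ht1).2 (Or.inr rfl)) (fun h => ht ⟨_, h⟩) hl3
    omega
  have e2 : (1 : ZMod g) + 1 = 2 := by norm_num
  have e0 : (1 : ZMod g) - 1 = 0 := by simp
  have a2 : M.Adj (v 1) (v 2) := by
    rw [hA, e2]
    exact Or.inl rfl
  have a0 : M.Adj (v 1) (v 0) := by
    rw [hA, e0]
    exact Or.inr (Or.inl rfl)
  have hne : v 2 ≠ v 0 := by
    intro h
    apply natCast_ne_zero (g := g) (k := 2) (by omega) (by omega)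
    push_cast
    exact F.inj h
  rcases eq_or_ne (v 2) c with h2c | h2c
  · exact key 0 a0 (fun h => hne (h2c.trans h.symm)) (h0 ▸ hj)
  · exact key 2 a2 h2c (h2 ▸ hj')

lemma false_of_three_linked (F : Frame K v w) (h : Bad g K) {i a b c : ZMod g} (ha : a ≠ i)
    (hb : b ≠ i) (hc : c ≠ i) (hab : a ≠ b) (hac : a ≠ c) (hbc : b ≠ c)
    (la : Linked K (Set.range v) (g - 3) (w i) (w a))
    (lb : Linked K (Set.range v) (g - 3) (w i) (w b))
    (lc : Linked K (Set.range v) (g - 3) (w i) (w c)) : False := by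
  have h5 := h.five_le
  have step : ∀ j, j ≠ i → Linked K (Set.range v) (g - 3) (w i) (w j) → ∃ t, K.Adj (w i) t ∧
      t ∉ Set.range v ∧ Linked K (Set.range v ∪ {w i}) (g - 4) t (w j) := by
    intro j hj hl
    obtain ⟨t, ht, -, hl'⟩ := hl.exists_step fun h' => hj (F.inj_spoke h h').symm
    refine ⟨t, ht, hl'.left_notMem, (hl'.avoid_or (w i)).resolve_right fun hl'' => ?_⟩
    have := F.le_of_linked h hj.symm hl''
    omega
  have branch : ∀ j j' t, j ≠ i → j' ≠ i → j ≠ j' → K.Adj (w i) t → t ∉ Set.range v →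
      Linked K (Set.range v ∪ {w i}) (g - 4) t (w j) →
      Linked K (Set.range v ∪ {w i}) (g - 4) t (w j') → False :=
    fun j j' t hj hj' hjj' ht htv => F.false_of_branch h hj hj' hjj' (F.off i) (Or.inl rfl) ht htv
      ht.ne'
  obtain ⟨ta, hta, nta, la⟩ := step a ha la
  obtain ⟨tb, htb, ntb, lb⟩ := step b hb lb
  obtain ⟨tc, htc, ntc, lc⟩ := step c hc lc
  have hne : ∀ t, t ∉ Set.range v → t ≠ v i := fun t ht h => ht ⟨_, h.symm⟩
  rcases h.cubic.eq_or_eq_or_eq (F.spoke i).symm hta htb htc (hne _ nta) (hne _ ntb) (hne _ ntc)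
    with rfl | rfl | rfl
  · exact branch a b _ ha hb hab hta nta la lb
  · exact branch a c _ ha hc hac hta nta la lc
  · exact branch b c _ hb hc hbc htb ntb lb lc

lemma linked_or_linked (F : Frame K v w) (h : Bad g K) {i j k l : ZMod g} (hij : i ≠ j)
    (hik : i ≠ k) (hil : i ≠ l) (hjk : j ≠ k) (hjl : j ≠ l) (hkl : k ≠ l)
    (hl : Linked K (Set.range v) (g - 3) (w i) (w j)) :
    Linked K (Set.range v) (g - 3) (w i) (w k) ∨ Linked K (Set.range v) (g - 3) (w j) (w l) := by
  classical
  have h5 := h.five_le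
  have : NeZero g := ⟨by omega⟩
  obtain ⟨σ, rfl, rfl, rfl, rfl⟩ := exists_perm_four h5 hij hik hil hjk hjl hkl
  obtain ⟨M, hM, -, hKM, FM⟩ := F.exists_arrange h5 h σ
  obtain ⟨N, hN, hcard, hMN, FN⟩ := FM.exists_swap h5 hM 1
  have n1 := natCast_ne_zero (g := g) (k := 1) (by omega) (by omega)
  have n2 := natCast_ne_zero (g := g) (k := 2) (by omega) (by omega)
  have n3 := natCast_ne_zero (g := g) (k := 3) (by omega) (by omega)
  push_cast at n1 n2 n3
  have e2 : (1 : ZMod g) + 1 = 2 := by norm_num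
  have e3 : (2 : ZMod g) + 1 = 3 := by norm_num
  have e01 : (0 : ZMod g) ≠ 1 := n1.symm
  have e02 : (0 : ZMod g) ≠ 2 := n2.symm
  have e31 : (3 : ZMod g) ≠ 1 := fun h => n2 (by linear_combination h)
  have e32 : (3 : ZMod g) ≠ 2 := fun h => n1 (by linear_combination h)
  rw [e2] at hMN FN
  have w0 : ((w ∘ σ) ∘ Equiv.swap 1 2) 0 = w (σ 0) := by
    simp [Equiv.swap_apply_of_ne_of_ne e01 e02]
  have w1 : ((w ∘ σ) ∘ Equiv.swap 1 2) 1 = w (σ 2) := by simp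
  have w2 : ((w ∘ σ) ∘ Equiv.swap 1 2) 2 = w (σ 1) := by simp
  have w3 : ((w ∘ σ) ∘ Equiv.swap 1 2) 3 = w (σ 3) := by
    simp [Equiv.swap_apply_of_ne_of_ne e31 e32]
  have hMN' : AgreeOff M N (Set.range v) := hMN.mono (by
    rintro u (rfl | rfl) <;> exact ⟨_, rfl⟩)
  have back : ∀ a b, Linked N (Set.range v) (g - 3) a b → Linked K (Set.range v) (g - 3) a b :=
    fun a b hl => (hKM.trans hMN').symm.linked hl subset_rfl
  obtain ⟨q, hq, hqv⟩ := hKM.linked hl subset_rfl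
  obtain ⟨S, hS⟩ : ∃ S : Finset V, ∀ z, z ∈ S ↔ z = v 0 ∨ z = v (0 + 1) ∨ z ∈ q.support :=
    ⟨insert (v 0) (insert (v (0 + 1)) q.support.toFinset), by simp⟩
  have hSM : S ∈ cycleSets g M :=
    FM.mem_cycleSets hM rfl (by simp) q (by omega) hqv hS
  by_cases hSN : S ∈ cycleSets g N
  · left
    have hne : (S : Set V) ≠ Set.range v := by
      intro h
      apply F.off (σ 0)
      rw [← h]
      exact (hS _).2 (by simp)
    obtain ⟨a, r, hr, hrv, hSr⟩ := FN.exists_walk_of_mem_cycleSets hN hSN hne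
      (i₀ := 0) ((hS _).2 (Or.inl rfl))
    have hv : ∀ b, v b ∈ S → b = a ∨ b = a + 1 := by
      intro b hb
      rcases (hSr _).1 hb with h | h | h
      · exact Or.inl (F.inj h)
      · exact Or.inr (F.inj h)
      · exact absurd ⟨_, rfl⟩ (hrv _ h)
    have ha : a = 0 := by
      rcases hv 0 ((hS _).2 (Or.inl rfl)) with h0 | h0
      · exact h0.symm
      · rcases hv 1 ((hS _).2 (Or.inr (Or.inl (by rw [zero_add])))) with h1 | h1
        · exact absurd (by rw [← h1] at h0; linear_combination -h0) n2
        · exact absurd (h0.trans h1.symm) e01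
    subst ha
    have hlr : Linked N (Set.range v) (g - 3) _ _ := ⟨r, by omega, hrv⟩
    rw [zero_add, w0, w1] at hlr
    exact back _ _ hlr
  · obtain ⟨T, hTN, hTM⟩ : ∃ T ∈ cycleSets g N, T ∉ cycleSets g M := by
      by_contra! hsub
      exact hSN (eq_of_subset_of_card_le hsub hcard.ge ▸ hSM)
    have hne : (T : Set V) ≠ Set.range v := fun h => hTM (FM.range_mem_cycleSets hM h)
    obtain ⟨b, hb, hbT⟩ : ∃ b : ZMod g, (b = 1 ∨ b = 2) ∧ v b ∈ T := by
      by_contra! hT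
      apply hTM
      obtain ⟨hc, hT'⟩ := CubicDeck.mem_cycleSets.1 hTN
      refine CubicDeck.mem_cycleSets.2 ⟨hc, hT'.congr fun u hu u' hu' => ?_⟩
      have hoff : ∀ u ∈ (T : Set V), u ∉ ({v 1, v 2} : Set V) := by
        rintro u hu (rfl | rfl)
        · exact hT 1 (Or.inl rfl) hu
        · exact hT 2 (Or.inr rfl) hu
      exact (hMN u (hoff u hu) u' (hoff u' hu')).2
    obtain ⟨a, r, hr, hrv, hTr⟩ := FN.exists_walk_of_mem_cycleSets hN hTN hne hbT
    have hba : b = a ∨ b = a + 1 := by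
      rcases (hTr _).1 hbT with h | h | h
      · exact Or.inl (F.inj h)
      · exact Or.inr (F.inj h)
      · exact absurd ⟨_, rfl⟩ (hrv _ h)
    have hlr : Linked N (Set.range v) (g - 3) _ _ := ⟨r, by omega, hrv⟩
    have ha : a = 0 ∨ a = 1 ∨ a = 2 := by
      rcases hb with rfl | rfl <;> rcases hba with h | h
      · exact Or.inr (Or.inl h.symm)
      · exact Or.inl (by linear_combination -h)
      · exact Or.inr (Or.inr h.symm)
      · exact Or.inr (Or.inl (by linear_combination -h))
    rcases ha with rfl | rfl | rfl
    · left
      rw [zero_add, w0, w1] at hlr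
      exact back _ _ hlr
    · exfalso
      apply hTM
      have hrM := exists_transfer (S := (Set.range v)ᶜ) (M := M)
        (fun u hu u' hu' => (hMN' u hu u' hu').2) r hrv
      refine FM.mem_cycleSets hM (i := 1) (by rw [e2, w2]; rfl) (by rw [e2, w1]; rfl)
        (r.transfer M hrM).reverse (by simpa using hr) (by simpa using hrv) (by simpa using hTr)
    · right
      rw [e3, w2, w3] at hlr
      exact back _ _ hlr

lemma not_linked (F : Frame K v w) (h : Bad g K) {i j : ZMod g} (hij : i ≠ j) :
    ¬ Linked K (Set.range v) (g - 3) (w i) (w j) := by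
  classical
  intro hl
  have h5 := h.five_le
  have : NeZero g := ⟨by omega⟩
  have hc : 2 < (({i, j} : Finset (ZMod g))ᶜ).card := by
    rw [card_compl, ZMod.card, card_pair hij]
    omega
  obtain ⟨k, hk, l, hl', m, hm, hkl, hkm, hlm⟩ := two_lt_card.1 hc
  simp only [mem_compl, mem_insert, mem_singleton, not_or] at hk hl' hm
  have key : ∀ k l : ZMod g, k ≠ i ∧ k ≠ j → l ≠ i ∧ l ≠ j → k ≠ l →
      Linked K (Set.range v) (g - 3) (w i) (w k) ∨
        Linked K (Set.range v) (g - 3) (w j) (w l) := fun k l hk hl' hkl =>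
    F.linked_or_linked h hij hk.1.symm hl'.1.symm hk.2.symm hl'.2.symm hkl hl
  have ni : ∀ k l : ZMod g, k ≠ i ∧ k ≠ j → l ≠ i ∧ l ≠ j → k ≠ l →
      Linked K (Set.range v) (g - 3) (w i) (w k) →
        ¬ Linked K (Set.range v) (g - 3) (w i) (w l) := fun k l hk hl' hkl h1 h2 =>
    F.false_of_three_linked h hij.symm hk.1 hl'.1 hk.2.symm hl'.2.symm hkl hl h1 h2
  have nj : ∀ k l : ZMod g, k ≠ i ∧ k ≠ j → l ≠ i ∧ l ≠ j → k ≠ l →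
      Linked K (Set.range v) (g - 3) (w j) (w k) →
        ¬ Linked K (Set.range v) (g - 3) (w j) (w l) := fun k l hk hl' hkl h1 h2 =>
    F.false_of_three_linked h hij hk.2 hl'.2 hk.1.symm hl'.1.symm hkl hl.symm h1 h2
  have k1 := key k l hk hl' hkl
  have k2 := key k m hk hm hkm
  have k3 := key l k hl' hk hkl.symm
  have k4 := key l m hl' hm hlm
  have k5 := key m k hm hk hkm.symm
  have k6 := key m l hm hl' hlm.symm
  have i1 := ni k l hk hl' hkl
  have i2 := ni k m hk hm hkm
  have i3 := ni l m hl' hm hlm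
  have j1 := nj k l hk hl' hkl
  have j2 := nj k m hk hm hkm
  have j3 := nj l m hl' hm hlm
  clear key ni nj
  grind

end Frame

lemma disjoint_of_mem_cycleSets [Fintype V] {g : ℕ} {K : SimpleGraph V} (h : Bad g K)
    {S T : Finset V} (hS : S ∈ cycleSets g K) (hT : T ∈ cycleSets g K) (hST : S ≠ T) :
    Disjoint S T := by
  have h5 := h.five_le
  have : NeZero g := ⟨by omega⟩
  rw [Finset.disjoint_left]
  intro z hzS hzT
  obtain ⟨v, w, F, hv⟩ := exists_frame h hS
  obtain ⟨i, rfl⟩ : z ∈ Set.range v := hv ▸ hzS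
  obtain ⟨a, r, hr, hrv, -⟩ := F.exists_walk_of_mem_cycleSets h hT
    (fun h => hST (coe_injective (hv.symm.trans h.symm))) hzT
  refine F.not_linked h (fun h => ?_) ⟨r, by omega, hrv⟩
  apply natCast_ne_zero (g := g) (k := 1) (by omega) (by omega)
  push_cast
  linear_combination -h

/-! ### Two `g`-cycles joined by an edge -/

section Join

variable [Fintype V] {g : ℕ} {K : SimpleGraph V}

namespace Frame

variable {v w : ZMod g → V}

lemma le_of_linked_adj (F : Frame K v w) (h : Bad g K) {p j : ZMod g} (hjp : j ≠ p) {c : V}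
    (hc : K.Adj (w p) c) {k : ℕ} (hl : Linked K (Set.range v ∪ {w p}) k (w j) c) : g ≤ k + 3 := by
  by_contra! hlt
  exact F.not_linked h hjp.symm
    (((hl.symm.mono Set.subset_union_left le_rfl).cons hc (F.off p)).mono subset_rfl (by omega))

lemma false_of_three_linked_adj (F : Frame K v w) (h : Bad g K) {p a b e : ZMod g} (ha : a ≠ p)
    (hb : b ≠ p) (he : e ≠ p) (hab : a ≠ b) (hae : a ≠ e) (hbe : b ≠ e) {c : V}
    (hc : K.Adj (w p) c) (la : Linked K (Set.range v ∪ {w p}) (g - 3) (w a) c)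
    (lb : Linked K (Set.range v ∪ {w p}) (g - 3) (w b) c)
    (le : Linked K (Set.range v ∪ {w p}) (g - 3) (w e) c) : False := by
  have h5 := h.five_le
  have hcX : c ∉ Set.range v ∪ {w p} := la.right_notMem
  have hcv : c ∉ Set.range v := fun h => hcX (Or.inl h)
  have step : ∀ j, j ≠ p → Linked K (Set.range v ∪ {w p}) (g - 3) (w j) c → ∃ t, K.Adj c t ∧
      t ∉ Set.range v ∧ t ≠ w p ∧ Linked K (Set.range v ∪ {c}) (g - 4) t (w j) := by
    intro j hj hl
    have hne : c ≠ w j := by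
      intro h'
      have := F.le_of_linked_adj h hj hc (k := 0) ⟨Walk.nil.copy rfl h'.symm, by simp, by
        intro z hz
        simp only [Walk.support_copy, Walk.support_nil, List.mem_singleton] at hz
        rwa [hz, ← h']⟩
      omega
    obtain ⟨t, ht, -, hl'⟩ := hl.symm.exists_step hne
    have htX := hl'.left_notMem
    refine ⟨t, ht, fun h => htX (Or.inl h), fun h => htX (Or.inr h), ?_⟩
    rcases hl'.avoid_or c with hl'' | hl''
    · exact hl''.mono (Set.union_subset_union_left _ Set.subset_union_left) (by omega)
    · have := F.le_of_linked_adj h hj hc hl''.symm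
      omega
  have branch : ∀ j j' t, j ≠ p → j' ≠ p → j ≠ j' → K.Adj c t → t ∉ Set.range v → t ≠ w p →
      Linked K (Set.range v ∪ {c}) (g - 4) t (w j) →
      Linked K (Set.range v ∪ {c}) (g - 4) t (w j') → False :=
    fun j j' t hj hj' hjj' => F.false_of_branch h hj hj' hjj' hcv (Or.inr hc.symm)
  obtain ⟨ta, hta, nta, pta, la⟩ := step a ha la
  obtain ⟨tb, htb, ntb, ptb, lb⟩ := step b hb lb
  obtain ⟨te, hte, nte, pte, le⟩ := step e he le
  rcases h.cubic.eq_or_eq_or_eq hc.symm hta htb hte pta ptb pte with rfl | rfl | rfl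
  · exact branch a b _ ha hb hab hta nta pta la lb
  · exact branch a e _ ha he hae hta nta pta la le
  · exact branch b e _ hb he hbe htb ntb ptb lb le

lemma linked_of_linked_pair (F : Frame K v w) (h : Bad g K) {p q : ZMod g} {c : V}
    (hc : K.Adj (w p) c) (hcv : c ∉ Set.range v)
    (hl : Linked K {v p, w p} (g - 2) (v q) c) :
    Linked K (Set.range v ∪ {w p}) (g - 3) (w q) c := by
  obtain ⟨r, hr, hrX⟩ := hl.symm
  obtain ⟨u, s, r₁, hus, r₂, ⟨j, rfl⟩, hr₁, hrr⟩ := exists_first_hit (Set.range v) r hcv ⟨q, rfl⟩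
  obtain rfl : u = w j := F.eq_spoke h hus.symm (hr₁ u r₁.end_mem_support)
  have hjp : j ≠ p := by
    rintro rfl
    exact hrX (v j) (by rw [hrr]; simp) (Or.inl rfl)
  have hl₁ : Linked K (Set.range v ∪ {w p}) r₁.length c (w j) := by
    refine ⟨r₁, le_rfl, ?_⟩
    rintro z hz (hzv | hzp)
    · exact hr₁ z hz hzv
    · exact hrX z (by rw [hrr, Walk.mem_support_append_iff]; exact Or.inl hz) (Or.inr hzp)
  have hge := F.le_of_linked_adj h hjp hc hl₁.symm
  have hlen := congrArg Walk.length hrr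
  rw [Walk.length_append, Walk.length_cons] at hlen
  obtain rfl : j = q := F.inj (Walk.eq_of_length_eq_zero (p := r₂) (by omega))
  exact hl₁.symm.mono subset_rfl (by omega)

end Frame

/-- If `x` and `y` lie on distinct `g`-cycles of `K` and `M` differs from `K` only at the edges of
`x` and `y`, then the two vertices lie on disjoint `g`-cycles of `M`. -/
lemma exists_cycles_of_agreeOff {M : SimpleGraph V} (hM : Bad g M) {x y : V}
    (hcard : (cycleSets g M).card = (cycleSets g K).card) (hKM : AgreeOff K M {x, y})
    {S T : Finset V} (hS : S ∈ cycleSets g K) (hT : T ∈ cycleSets g K) (hST : S ≠ T)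
    (hxS : x ∈ S) (hyT : y ∈ T) :
    ∃ A ∈ cycleSets g M, ∃ B ∈ cycleSets g M, x ∈ A ∧ y ∉ A ∧ y ∈ B ∧ x ∉ B := by
  classical
  have hiff : ∀ A : Finset V, ¬ (x ∈ A ∨ y ∈ A) → (A ∈ cycleSets g K ↔ A ∈ cycleSets g M) := by
    intro A hA
    have hoff : ∀ u ∈ (A : Set V), u ∉ ({x, y} : Set V) := by
      rintro u hu (rfl | rfl)
      · exact hA (Or.inl hu)
      · exact hA (Or.inr hu)
    rw [mem_cycleSets, mem_cycleSets]
    exact and_congr_right fun _ =>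
      ⟨fun h => h.congr fun u hu u' hu' => (hKM u (hoff u hu) u' (hoff u' hu')).1,
        fun h => h.congr fun u hu u' hu' => (hKM u (hoff u hu) u' (hoff u' hu')).2⟩
  have heq : (cycleSets g K).filter (fun A => ¬ (x ∈ A ∨ y ∈ A)) =
      (cycleSets g M).filter fun A => ¬ (x ∈ A ∨ y ∈ A) := by
    ext A
    simp only [mem_filter]
    exact and_congr_left (hiff A)
  have hlt : 1 < ((cycleSets g K).filter fun A => x ∈ A ∨ y ∈ A).card :=
    one_lt_card.2 ⟨S, by simp [hS, hxS], T, by simp [hT, hyT], hST⟩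
  have k1 := card_filter_add_card_filter_not (s := cycleSets g K) fun A => x ∈ A ∨ y ∈ A
  have k2 := card_filter_add_card_filter_not (s := cycleSets g M) fun A => x ∈ A ∨ y ∈ A
  rw [heq] at k1
  obtain ⟨A, hA, B, hB, hAB⟩ := one_lt_card.1
    (show 1 < ((cycleSets g M).filter fun A => x ∈ A ∨ y ∈ A).card by omega)
  rw [mem_filter] at hA hB
  have hd := Finset.disjoint_left.1 (disjoint_of_mem_cycleSets hM hA.1 hB.1 hAB)
  have hx := hd (a := x)
  have hy := hd (a := y)
  by_cases hxA : x ∈ A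
  · exact ⟨A, hA.1, B, hB.1, by tauto⟩
  · exact ⟨B, hB.1, A, hA.1, by tauto⟩

lemma linked_of_mem_cycleSets (hg : GirthGE g K) {A : Finset V} (hA : A ∈ cycleSets g K)
    {x y a b : V} (hxA : x ∈ A) (hyA : y ∉ A) (hx : ∀ u, K.Adj x u → u ≠ y → u = a ∨ u = b) :
    Linked K {x, y} (g - 2) a b := by
  obtain ⟨a', b', r, ha, hb, hab, -, hl, hxr, hr⟩ := exists_arc_of_mem_cycleSets hg hA hxA
  have hmem : ∀ z ∈ r.support, z ∈ A := fun z hz => (hr z).2 (Or.inr hz)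
  have hl' : Linked K {x, y} (g - 2) a' b' := by
    refine ⟨r, by omega, ?_⟩
    rintro z hz (rfl | rfl)
    · exact hxr hz
    · exact hyA (hmem _ hz)
  have hne : ∀ z ∈ r.support, z ≠ y := fun z hz h => hyA (h ▸ hmem z hz)
  rcases hx a' ha (hne _ r.start_mem_support) with rfl | rfl <;>
    rcases hx b' hb (hne _ r.end_mem_support) with rfl | rfl
  · exact absurd rfl hab
  · exact hl'
  · exact hl'.symm
  · exact absurd rfl hab

namespace Frame

variable {v w : ZMod g → V}

lemma exists_linked_pair (F : Frame K v w) (h : Bad g K) {p i i' : ZMod g} (hip : i ≠ p)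
    (hip' : i' ≠ p) (hii' : i ≠ i') {c d : V} (hcd : c ≠ d)
    (hN : ∀ u, K.Adj (w p) u ↔ u = v p ∨ u = c ∨ u = d) (hcv : c ∉ Set.range v)
    (hdv : d ∉ Set.range v) {S : Finset V} (hS : S ∈ cycleSets g K) (hpS : w p ∈ S)
    (hSv : ∀ z ∈ S, z ∉ Set.range v) :
    (Linked K (Set.range v ∪ {w p}) (g - 3) (w i) c ∧
        Linked K (Set.range v ∪ {w p}) (g - 3) (w i') d) ∨
      (Linked K (Set.range v ∪ {w p}) (g - 3) (w i) d ∧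
        Linked K (Set.range v ∪ {w p}) (g - 3) (w i') c) := by
  classical
  have h5 := h.five_le
  have : NeZero g := ⟨by omega⟩
  obtain ⟨σ, rfl, rfl, rfl⟩ := exists_perm_three h5 hip hii' hip'.symm
  obtain ⟨M, hM, -, hKM, FM⟩ := F.exists_arrange h5 h σ
  have e2 : (1 : ZMod g) + 1 = 2 := by norm_num
  have e0 : (1 : ZMod g) - 1 = 0 := by simp
  have hvw := F.v_ne_w
  have hsp : M.Adj (v 1) (w (σ 1)) := FM.spoke 1
  have hNM : ∀ u, M.Adj (w (σ 1)) u ↔ u = v 1 ∨ u = c ∨ u = d := by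
    intro u
    by_cases hu : u ∈ Set.range v
    · obtain ⟨k, rfl⟩ := hu
      have hck : v k ≠ c := fun h => hcv ⟨k, h⟩
      have hdk : v k ≠ d := fun h => hdv ⟨k, h⟩
      rw [M.adj_comm, FM.adj_iff h5 hM.cubic]
      simp only [hck, hdk, or_false, (hvw _ _).symm, false_or]
      constructor
      · intro h'
        rw [F.inj_spoke h h' |> σ.injective]
      · intro h'
        rw [F.inj h']
        rfl
    · rw [← hKM _ (F.off _) _ hu, hN]
      have h1 : u ≠ v 1 := fun h => hu ⟨_, h.symm⟩
      have h2 : u ≠ v (σ 1) := fun h => hu ⟨_, h.symm⟩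
      simp [h1, h2]
  have hSM : S ∈ cycleSets g M := by
    obtain ⟨hc, hS'⟩ := CubicDeck.mem_cycleSets.1 hS
    exact CubicDeck.mem_cycleSets.2
      ⟨hc, hS'.congr fun u hu u' hu' => (hKM u (hSv u hu) u' (hSv u' hu')).1⟩
  have hCM : univ.image v ∈ cycleSets g M := FM.range_mem_cycleSets hM (by simp)
  have a0 : M.Adj (v 1) (v 0) := by
    rw [FM.adj_iff h5 hM.cubic, e0]
    exact Or.inr (Or.inl rfl)
  have h01 : v 0 ≠ v 1 := a0.ne'
  have h0c : ∀ e, e ∉ Set.range v → ∀ k, v k ≠ e := fun e he k h => he ⟨k, h⟩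
  obtain ⟨e, he, he1, -, N, hMN', hcard, hMN, -, hN1, hNp⟩ := hM.exists_switch hsp.ne
    (Or.inl hsp) a0 (hvw _ _) (by
      rw [hNM]
      simp [h01, h0c c hcv, h0c d hdv])
  obtain ⟨A, hA, B, hB, h1A, hpA, hpB, h1B⟩ := exists_cycles_of_agreeOff hMN' hcard hMN hCM hSM
    (fun h => hSv _ hpS (by rw [← h] at hpS; simpa using hpS)) (by simp) hpS
  obtain ⟨f, hef, hev, hfv, hNM'⟩ : ∃ f, ((e = c ∧ f = d) ∨ (e = d ∧ f = c)) ∧ e ∉ Set.range v ∧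
      f ∉ Set.range v ∧ ∀ u, M.Adj (w (σ 1)) u ↔ u = v 1 ∨ u = e ∨ u = f := by
    rcases ((hNM e).1 he).resolve_left he1 with rfl | rfl
    · exact ⟨d, Or.inl ⟨rfl, rfl⟩, hcv, hdv, hNM⟩
    · exact ⟨c, Or.inr ⟨rfl, rfl⟩, hdv, hcv, fun u => by rw [hNM, or_comm (a := u = c)]⟩
  have l2 : Linked N {v 1, w (σ 1)} (g - 2) (v 2) e := by
    refine linked_of_mem_cycleSets hMN'.girth hA h1A hpA fun u hu hup => ?_
    rcases (hN1 u hu.ne' hup).1 hu with ⟨h', h0⟩ | h'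
    · rcases (FM.adj_iff h5 hM.cubic 1 u).1 h' with h'' | h'' | h''
      · exact Or.inl (by rw [h'', e2])
      · exact absurd (by rw [h'', e0]) h0
      · exact absurd h'' hup
    · exact Or.inr h'
  have l0 : Linked N {w (σ 1), v 1} (g - 2) (v 0) f := by
    refine linked_of_mem_cycleSets hMN'.girth hB hpB h1B fun u hu hu1 => ?_
    rcases (hNp u hu1 hu.ne').1 hu with ⟨h', h0⟩ | h'
    · exact Or.inr ((((hNM' u).1 h').resolve_left hu1).resolve_left h0)
    · exact Or.inl h'
  rw [Set.pair_comm] at l0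
  have k2 := hKM.symm.linked (FM.linked_of_linked_pair hM (p := 1) ((hNM' e).2 (by simp)) hev
    (hMN.symm.linked l2 subset_rfl)) Set.subset_union_left
  have k0 := hKM.symm.linked (FM.linked_of_linked_pair hM (p := 1) ((hNM' f).2 (by simp)) hfv
    (hMN.symm.linked l0 subset_rfl)) Set.subset_union_left
  rcases hef with ⟨rfl, rfl⟩ | ⟨rfl, rfl⟩
  · exact Or.inr ⟨k0, k2⟩
  · exact Or.inl ⟨k0, k2⟩

end Frame

lemma Bad.false_of_adj (h : Bad g K) {C S : Finset V} (hC : C ∈ cycleSets g K)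
    (hS : S ∈ cycleSets g K) (hCS : C ≠ S) {x y : V} (hx : x ∈ C) (hy : y ∈ S)
    (hxy : K.Adj x y) : False := by
  classical
  have h5 := h.five_le
  have : NeZero g := ⟨by omega⟩
  obtain ⟨v, w, F, hv⟩ := exists_frame h hC
  have hSv : ∀ z ∈ S, z ∉ Set.range v := by
    intro z hz hzv
    rw [hv] at hzv
    exact Finset.disjoint_left.1 (disjoint_of_mem_cycleSets h hC hS hCS) hzv hz
  obtain ⟨p, rfl⟩ : x ∈ Set.range v := hv ▸ hx
  obtain rfl : y = w p := F.eq_spoke h hxy (hSv y hy)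
  obtain ⟨c, d, r, hc, hd, hcd, -, -, -, hr⟩ := exists_arc_of_mem_cycleSets h.girth hS hy
  have hcv := hSv c ((hr c).2 (by simp))
  have hdv := hSv d ((hr d).2 (by simp))
  have hN : ∀ u, K.Adj (w p) u ↔ u = v p ∨ u = c ∨ u = d := by
    intro u
    constructor
    · intro hu
      by_cases hup : u = v p
      · exact Or.inl hup
      · rcases h.cubic.eq_or_eq_or_eq hxy.symm hu hc hd hup (fun h => hcv ⟨p, h.symm⟩)
          (fun h => hdv ⟨p, h.symm⟩) with h' | h' | h'
        · exact Or.inr (Or.inl h')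
        · exact Or.inr (Or.inr h')
        · exact absurd h' hcd
    · rintro (rfl | rfl | rfl)
      · exact hxy.symm
      · exact hc
      · exact hd
  obtain ⟨T, hT, hT4⟩ := exists_subset_card_eq (s := ({p} : Finset (ZMod g))ᶜ) (n := 4) (by
    rw [card_compl, ZMod.card, card_singleton]
    omega)
  obtain ⟨i, j, k, l, hij, hik, hil, hjk, hjl, hkl, rfl⟩ := card_eq_four.1 hT4
  have hne : ∀ a ∈ ({i, j, k, l} : Finset (ZMod g)), a ≠ p := fun a ha => by simpa using hT ha
  have hi := hne i (by simp)
  have hj := hne j (by simp)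
  have hk := hne k (by simp)
  have hl := hne l (by simp)
  have pair := fun {a b : ZMod g} (ha : a ≠ p) (hb : b ≠ p) (hab : a ≠ b) =>
    F.exists_linked_pair h ha hb hab hcd hN hcv hdv hS hy hSv
  have three := fun {e : V} (he : K.Adj (w p) e) {a b b' : ZMod g} (ha : a ≠ p) (hb : b ≠ p)
    (hb' : b' ≠ p) (hab : a ≠ b) (hab' : a ≠ b') (hbb' : b ≠ b') =>
    F.false_of_three_linked_adj h ha hb hb' hab hab' hbb' he
  have p1 := pair hi hj hij
  have p2 := pair hi hk hik
  have p3 := pair hi hl hil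
  have p4 := pair hj hk hjk
  have p5 := pair hj hl hjl
  have p6 := pair hk hl hkl
  have c1 := three hc hi hj hk hij hik hjk
  have c2 := three hc hi hj hl hij hil hjl
  have c3 := three hc hi hk hl hik hil hkl
  have c4 := three hc hj hk hl hjk hjl hkl
  have d1 := three hd hi hj hk hij hik hjk
  have d2 := three hd hi hj hl hij hil hjl
  have d3 := three hd hi hk hl hik hil hkl
  have d4 := three hd hj hk hl hjk hjl hkl
  clear pair three hne
  grind

end Join

lemma _root_.SimpleGraph.Walk.IsCycle.mem_edges_of_adj {g : ℕ} {K : SimpleGraph V} (h3 : 3 ≤ g)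
    (hg : GirthGE g K) {x u z : V} {c : K.Walk x x} (hc : c.IsCycle) (hl : c.length ≤ g)
    (hu : u ∈ c.support) (hz : z ∈ c.support) (huz : K.Adj u z) : s(u, z) ∈ c.edges := by
  classical
  rw [← (c.rotate_edges u hu).mem_iff]
  rw [← Walk.mem_support_rotate_iff c u hu] at hz
  rw [← Walk.length_rotate c u hu] at hl
  replace hc := hc.rotate hu
  generalize c.rotate u hu = c at *
  by_contra hne
  cases c with
  | nil => exact absurd hc (by simp)
  | cons h q =>
    rename_i a
    rw [Walk.cons_isCycle_iff] at hc
    rw [Walk.edges_cons, List.mem_cons, not_or] at hne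
    have hzq : z ∈ q.support := by
      rw [Walk.support_cons, List.mem_cons] at hz
      exact hz.resolve_left huz.ne'
    have haz : a ≠ z := by
      rintro rfl
      exact hne.1 rfl
    have h1 := hg.le_length h huz haz (q.takeUntil z hzq)
      (Walk.endpoint_notMem_support_takeUntil hc.1 hzq huz.ne)
    have hcyc : (Walk.cons huz (q.dropUntil z hzq)).IsCycle :=
      (Walk.cons_isCycle_iff _ _).2
        ⟨hc.1.dropUntil hzq, fun he => hne.2 (q.edges_dropUntil_subset_edges hzq he)⟩
    have h2 := hg _ ⟨u, _, hcyc, fun y hy => List.mem_toFinset.2 hy⟩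
    rw [hcyc.card_support_toFinset, Walk.length_cons] at h2
    have h4 := congrArg Walk.length (q.take_spec hzq)
    rw [Walk.length_append] at h4
    rw [Walk.length_cons] at hl
    omega

lemma girthGE_of_egirth_eq {g : ℕ} {K : SimpleGraph V} (hg : K.egirth = g) : GirthGE g K := by
  classical
  rintro S ⟨x, c, hc, hS⟩
  have h1 : (g : ℕ∞) ≤ c.length := hg ▸ egirth_le_length hc
  rw [← hc.card_support_toFinset, Nat.cast_le] at h1
  exact h1.trans (card_le_card fun z hz => hS z (by simpa using hz))

lemma _root_.SimpleGraph.IsRegularOfDegree.cubic [Fintype V] {K : SimpleGraph V}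
    [DecidableRel K.Adj] (h : K.IsRegularOfDegree 3) : Cubic K := by
  intro x
  rw [← h x, ← card_neighborFinset_eq_degree]
  congr 1
  ext u
  simp

end CubicDeck

/-- Standing hypotheses: `G` and `H` are 3-regular graphs on the same number `n` of vertices
with the same `(n-2)`-deck, `H` is not isomorphic to `G`, and `g` is the girth of `G`. -/
theorem no_edge_joining_distinct_g_cycles
    {V W : Type*} [Fintype V] [Fintype W] [DecidableEq V] [DecidableEq W]
    (G : SimpleGraph V) (H : SimpleGraph W)
    [DecidableRel G.Adj] [DecidableRel H.Adj]
    (hG : G.IsRegularOfDegree 3) (hH : H.IsRegularOfDegree 3)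
    (hcard : Fintype.card V = Fintype.card W)
    (hdeck : SameDeck G H (Fintype.card V - 2))
    (hniso : ¬ Nonempty (G ≃g H))
    (g : ℕ) (hgirth : G.egirth = g)
    :
    ¬ ∃ (x y : V) (v₁ v₂ : V) (C : G.Walk v₁ v₁) (D : G.Walk v₂ v₂),
      G.Adj x y ∧ C.IsCycle ∧ D.IsCycle ∧ C.length = g ∧ D.length = g ∧
      {e | e ∈ C.edges} ≠ {e | e ∈ D.edges} ∧
      x ∈ C.support ∧ y ∈ D.support := by
  rintro ⟨x, y, v₁, v₂, C, D, hxy, hC, hD, hCl, hDl, hne, hx, hy⟩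
  have hg := CubicDeck.girthGE_of_egirth_eq hgirth
  have h3 : 3 ≤ g := hCl ▸ hC.three_le_length
  have hCs : C.support.toFinset ∈ CubicDeck.cycleSets g G :=
    CubicDeck.mem_cycleSets.2 ⟨hC.card_support_toFinset.trans hCl,
      _, C, hC, fun z hz => by simpa using hz⟩
  have hDs : D.support.toFinset ∈ CubicDeck.cycleSets g G :=
    CubicDeck.mem_cycleSets.2 ⟨hD.card_support_toFinset.trans hDl,
      _, D, hD, fun z hz => by simpa using hz⟩
  refine (hdeck.bad hG.cubic hH.cubic hcard hniso hg hCs).false_of_adj hCs hDs (fun hCD => ?_)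
    (List.mem_toFinset.2 hx) (List.mem_toFinset.2 hy) hxy
  have hmem : ∀ z, z ∈ C.support ↔ z ∈ D.support := fun z => by
    rw [← List.mem_toFinset, hCD, List.mem_toFinset]
  apply hne
  ext e
  induction e using Sym2.ind with
  | _ a b =>
    constructor
    · intro he
      exact hD.mem_edges_of_adj h3 hg hDl.le
        ((hmem a).1 (C.fst_mem_support_of_mem_edges he))
        ((hmem b).1 (C.snd_mem_support_of_mem_edges he)) (C.adj_of_mem_edges he)
    · intro he
      exact hC.mem_edges_of_adj h3 hg hCl.le
        ((hmem a).2 (D.fst_mem_support_of_mem_edges he))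
        ((hmem b).2 (D.snd_mem_support_of_mem_edges he)) (D.adj_of_mem_edges he)
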